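/- Fix an integer d ≥ 3, let t = ⌊d/2⌋ − 1, and define β_d(r) = α(r)^t / t! if d is even and β_d(r) = (α(r)^t / t!) · log₂(α(r)) if d is odd; define δ_d(r) = 1/α(r) if d is even and δ_d(r) = 1/log₂(α(r)) if d is odd. Then there exist a constant C > 0 and a threshold r_0 (both depending only on d) such that for every real r ≥ r_0 and every integer n ≥ 2, the set diag(n) admits a weak (1/r)-net (with respect to convex sets) of size at most r · 2^{(1 + C·δ_d(r))·β_d(r)}. -/

import Mathlib

open Classical in
/-- `N` is a weak `ε`-net for the finite set `X ⊂ ℝ^d` with respect to convex sets. -/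
def IsWeakNet {d : ℕ} (X : Finset (Fin d → ℝ)) (ε : ℝ) (N : Set (Fin d → ℝ)) : Prop :=
  ∀ C : Set (Fin d → ℝ), Convex ℝ C →
    ε * X.card ≤ (X.filter (fun p => p ∈ C)).card → (N ∩ C).Nonempty

/-- The constants of the stretched grid: `K_1 = 2^d`, `K_{i+1} = 2^d · K_i^(n-1)`.
Here `stretchK d n i` denotes `K_{i+1}` (0-based index `i`). -/
def stretchK (d n : ℕ) : ℕ → ℝ
  | 0 => 2 ^ d
  | (i+1) => 2 ^ d * (stretchK d n i) ^ (n - 1)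

open Classical in
/-- The diagonal of the `d`-dimensional stretched grid:
`diag(n) = {(K_1^j, …, K_d^j) : j = 0, 1, …, n-1}`. -/
noncomputable def stretchedDiag (d n : ℕ) : Finset (Fin d → ℝ) :=
  (Finset.range n).image (fun j => fun i : Fin d => (stretchK d n i) ^ j)

/-- The Ackermann hierarchy: `ackH k n = A_{k+1}(n)`. -/
def ackH : ℕ → ℕ → ℕ
  | 0, n => 2 * n
  | _ + 1, 0 => 1
  | k + 1, n + 1 => ackH k (ackH (k + 1) n)

/-- The Ackermann function `A(n) = A_n(3)` (for `n ≥ 1`). -/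
def ackA (n : ℕ) : ℕ := ackH (n - 1) 3

/-- The inverse Ackermann function `α(x) = min {n ≥ 1 : A(n) ≥ x}`. -/
noncomputable def alphaA (x : ℝ) : ℕ := sInf {n : ℕ | 1 ≤ n ∧ x ≤ ackA n}

/-- `β_d(r) = α(r)^t/t!` for even `d` and `(α(r)^t/t!)·log₂ α(r)` for odd `d`,
where `t = ⌊d/2⌋ - 1`. -/
noncomputable def betaD (d : ℕ) (r : ℝ) : ℝ :=
  if d % 2 = 0 then (alphaA r : ℝ) ^ (d / 2 - 1) / (Nat.factorial (d / 2 - 1) : ℝ)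
  else ((alphaA r : ℝ) ^ (d / 2 - 1) / (Nat.factorial (d / 2 - 1) : ℝ)) *
    Real.logb 2 (alphaA r)

/-- `δ_d(r) = 1/α(r)` for even `d` and `1/log₂ α(r)` for odd `d`. -/
noncomputable def deltaD (d : ℕ) (r : ℝ) : ℝ :=
  if d % 2 = 0 then 1 / (alphaA r : ℝ) else 1 / Real.logb 2 (alphaA r)


/-- The tuple `(p 0, …, p (j-1))` interleaves with `j + 1` elements of `S`:
`s 0 ≤ p 0 < s 1 ≤ p 1 < ⋯ ≤ p (j-1) < s j`. -/
def Stabs (j : ℕ) (p : ℕ → ℕ) (S : Finset ℕ) : Prop :=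
  ∃ s : ℕ → ℕ, (∀ i ≤ j, s i ∈ S) ∧ ∀ i < j, s i ≤ p i ∧ p i < s (i + 1)

/-- Some family of at most `M` tuples of length `j` stabs every subset of `{0, …, n-1}` with more
than `k` elements. -/
def HasStab (j k n M : ℕ) : Prop :=
  ∃ T : Finset (ℕ → ℕ), T.card ≤ M ∧
    ∀ S : Finset ℕ, (∀ i ∈ S, i < n) → k < S.card → ∃ p ∈ T, Stabs j p S

lemma Stabs.mono {j : ℕ} {p : ℕ → ℕ} {S S' : Finset ℕ} (h : Stabs j p S) (hS : S ⊆ S') :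
    Stabs j p S' := by
  obtain ⟨s, h1, h2⟩ := h
  exact ⟨s, fun i hi => hS (h1 i hi), h2⟩

lemma HasStab.mono {j k k' n n' M M' : ℕ} (h : HasStab j k n M) (hk : k ≤ k') (hn : n' ≤ n)
    (hM : M ≤ M') : HasStab j k' n' M' := by
  obtain ⟨T, hT, h⟩ := h
  exact ⟨T, hT.trans hM, fun S hS hc =>
    h S (fun i hi => (hS i hi).trans_le hn) (hk.trans_lt hc)⟩

lemma hasStab_of_le {j k n M : ℕ} (h : n ≤ k) : HasStab j k n M := by
  refine ⟨∅, by simp, fun S hS hc => ?_⟩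
  have : S ⊆ Finset.range n := fun i hi => Finset.mem_range.2 (hS i hi)
  have := Finset.card_le_card this
  rw [Finset.card_range] at this
  omega

/-- Translation of a stabbing family to the window starting at `a`. -/
lemma HasStab.translate {j k n M : ℕ} (h : HasStab j k n M) (a : ℕ) :
    ∃ T : Finset (ℕ → ℕ), T.card ≤ M ∧
      ∀ S : Finset ℕ, (∀ i ∈ S, a ≤ i ∧ i < a + n) → k < S.card → ∃ p ∈ T, Stabs j p S := by
  classical
  obtain ⟨T, hT, h⟩ := h
  refine ⟨T.image (fun p i => p i + a), Finset.card_image_le.trans hT, fun S hS hc => ?_⟩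
  obtain ⟨p, hp, s, h1, h2⟩ := h (S.image (fun i => i - a))
    (by
      intro i hi
      obtain ⟨i', hi', rfl⟩ := Finset.mem_image.1 hi
      have := hS i' hi'
      omega)
    (by
      rw [Finset.card_image_of_injOn]
      · exact hc
      · intro u hu v hv huv
        have := hS u hu
        have := hS v hv
        simp only at huv
        omega)
  refine ⟨_, Finset.mem_image_of_mem _ hp, fun i => s i + a, ?_, ?_⟩
  · intro i hi
    obtain ⟨i', hi', he⟩ := Finset.mem_image.1 (h1 i hi)
    have := hS i' hi'
    have e : s i + a = i' := by omega
    simp only [e, hi']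
  · intro i hi
    have := h2 i hi
    simp only
    omega

lemma hasStab_one (n : ℕ) : HasStab 1 1 n n := by
  classical
  refine ⟨(Finset.range n).image (fun v _ => v), Finset.card_image_le.trans (by simp), ?_⟩
  intro S hS hc
  obtain ⟨a, ha, b, hb, hab⟩ := Finset.one_lt_card.1 hc
  wlog h : a < b generalizing a b
  · exact this b hb a ha hab.symm (by omega)
  refine ⟨_, Finset.mem_image_of_mem _ (Finset.mem_range.2 (hS a ha)),
    fun i => if i = 0 then a else b, ?_, ?_⟩
  · intro i _
    dsimp only
    split_ifs <;> assumption
  · intro i hi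
    obtain rfl : i = 0 := by omega
    simp [h]

lemma hasStab_two (n : ℕ) : HasStab 2 2 n n := by
  classical
  refine ⟨(Finset.range n).image (fun v i => if i = 0 then v - 1 else v),
    Finset.card_image_le.trans (by simp), ?_⟩
  intro S hS hc
  have hne : S.Nonempty := Finset.card_pos.1 (by omega)
  set a := S.min' hne with ha
  set b := S.max' hne with hb
  obtain ⟨v, hv⟩ : ((S.erase a).erase b).Nonempty := by
    apply Finset.card_pos.1
    have h1 := Finset.pred_card_le_card_erase (s := S) (a := a)
    have h2 := Finset.pred_card_le_card_erase (s := S.erase a) (a := b)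
    omega
  simp only [Finset.mem_erase] at hv
  have hav : a ≤ v := Finset.min'_le _ _ hv.2.2
  have hvb : v ≤ b := Finset.le_max' _ _ hv.2.2
  refine ⟨_, Finset.mem_image_of_mem _ (Finset.mem_range.2 (hS v hv.2.2)),
    fun i => if i = 0 then a else if i = 1 then v else b, ?_, ?_⟩
  · intro i _
    dsimp only
    split_ifs
    · exact Finset.min'_mem _ _
    · exact hv.2.2
    · exact Finset.max'_mem _ _
  · intro i hi
    obtain rfl | rfl : i = 0 ∨ i = 1 := by omega
    · simp only [if_true, zero_add, one_ne_zero, if_false]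
      omega
    · simp only [one_ne_zero, if_false, if_true, Nat.reduceAdd, OfNat.ofNat_ne_zero,
        OfNat.ofNat_ne_one]
      omega

/-- Appending an entry to a stabbing tuple. -/
lemma Stabs.append {j : ℕ} {p : ℕ → ℕ} {S S' : Finset ℕ} (h : Stabs j p S) (hS : S ⊆ S')
    {v z : ℕ} (hv : ∀ i ∈ S, i ≤ v) (hz : z ∈ S') (hvz : v < z) :
    Stabs (j + 1) (fun i => if i < j then p i else v) S' := by
  obtain ⟨s, h1, h2⟩ := h
  refine ⟨fun i => if i ≤ j then s i else z, ?_, ?_⟩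
  · intro i _
    dsimp only
    split_ifs with h
    · exact hS (h1 i h)
    · exact hz
  · intro i hi
    rcases Nat.lt_succ_iff_lt_or_eq.1 hi with h | rfl
    · have : i + 1 ≤ j := h
      simp only [h.le, h, this, if_true]
      exact h2 i h
    · have := hv _ (h1 i le_rfl)
      simp only [le_refl, if_true, lt_irrefl, if_false, show ¬ i + 1 ≤ i by omega]
      omega

/-- Prepending an entry to a stabbing tuple. -/
lemma Stabs.prepend {j : ℕ} {p : ℕ → ℕ} {S S' : Finset ℕ} (h : Stabs j p S) (hS : S ⊆ S')
    {v z : ℕ} (hv : ∀ i ∈ S, v < i) (hz : z ∈ S') (hvz : z ≤ v) :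
    Stabs (j + 1) (fun i => if i = 0 then v else p (i - 1)) S' := by
  obtain ⟨s, h1, h2⟩ := h
  refine ⟨fun i => if i = 0 then z else s (i - 1), ?_, ?_⟩
  · intro i hi
    dsimp only
    split_ifs with h
    · exact hz
    · exact hS (h1 _ (by omega))
  · intro i hi
    rcases i with _ | i
    · have := hv _ (h1 0 (Nat.zero_le _))
      simp [hvz, this]
    · have := h2 i (by omega)
      simpa using this

/-- A stabbing family for the set of blocks of length `s` lifts to the underlying points. -/
lemma Stabs.of_blocks {j s : ℕ} (hs : 0 < s) {p : ℕ → ℕ} {S : Finset ℕ}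
    (h : Stabs j p (S.image (fun i => i / s))) :
    Stabs j (fun i => s * (p i + 1) - 1) S := by
  obtain ⟨u, h1, h2⟩ := h
  have : ∀ i, ∃ v, i ≤ j → v ∈ S ∧ v / s = u i := by
    intro i
    by_cases hi : i ≤ j
    · obtain ⟨v, hv⟩ := Finset.mem_image.1 (h1 i hi)
      exact ⟨v, fun _ => hv⟩
    · exact ⟨0, fun h => absurd h hi⟩
  choose w hw using this
  refine ⟨w, fun i hi => (hw i hi).1, fun i hi => ?_⟩
  obtain ⟨ha, hb⟩ := h2 i hi
  rw [← (hw i hi.le).2] at ha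
  rw [← (hw (i + 1) hi).2] at hb
  have h3 : w i < s * (p i + 1) := by
    have := (Nat.div_lt_iff_lt_mul hs).1 (Nat.lt_succ_of_le ha)
    rwa [mul_comm] at this
  have h4 : s * (p i + 1) ≤ w (i + 1) := by
    have := (Nat.le_div_iff_mul_le hs).1 (Nat.succ_le_of_lt hb)
    rwa [mul_comm] at this
  simp only
  omega

/-- Block decomposition: stabbing families inside the blocks of length `s` and a stabbing family
for the set of blocks combine to a stabbing family. -/
lemma HasStab.block {j k k1 k2 k3 s n F0 F1 F2 M3 : ℕ} (hs : 0 < s)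
    (h0 : ∀ l ≤ s, HasStab (j + 2) k l (F0 * l))
    (h1 : ∀ l ≤ s, HasStab (j + 1) k1 l (F1 * l))
    (h2 : ∀ l ≤ s, HasStab j k2 l (F2 * l))
    (h3 : HasStab (j + 2) k3 (n / s + 1) M3)
    (hk : k3 * k2 + 2 * k1 ≤ k) :
    HasStab (j + 2) k n ((F0 + 2 * F1 + F2) * n + M3) := by
  classical
  let len : ℕ → ℕ := fun b => if b < n / s then s else n % s
  have hlen : ∀ b, len b ≤ s := by
    intro b
    dsimp only [len]
    split_ifs
    · exact le_rfl
    · exact (Nat.mod_lt _ hs).le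
  have hsum : ∑ b ∈ Finset.range (n / s + 1), len b = n := by
    rw [Finset.sum_range_succ, Finset.sum_congr rfl (g := fun _ => s)]
    · simp only [Finset.sum_const, Finset.card_range, smul_eq_mul, len, lt_irrefl, if_false]
      exact Nat.div_add_mod' n s
    · intro b hb
      simp only [len, Finset.mem_range.1 hb, if_true]
  choose T0 hT0 hS0 using fun b => (h0 (len b) (hlen b)).translate (s * b)
  choose T1 hT1 hS1 using fun b => (h1 (len b) (hlen b)).translate (s * b)
  choose T2 hT2 hS2 using fun b => (h2 (len b) (hlen b)).translate (s * b)
  obtain ⟨T3, hT3, hS3⟩ := h3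
  let app : ℕ → ℕ → (ℕ → ℕ) → (ℕ → ℕ) :=
    fun j v p i => if i < j then p i else v
  let pre : ℕ → (ℕ → ℕ) → (ℕ → ℕ) := fun v p i => if i = 0 then v else p (i - 1)
  let fam : ℕ → Finset (ℕ → ℕ) := fun b =>
    T0 b ∪ ((T1 b).image (app (j + 1) (s * b + s - 1)) ∪ ((T1 b).image (pre (s * b - 1)) ∪
      (T2 b).image (fun p => pre (s * b - 1) (app j (s * b + s - 1) p))))
  have hfam : ∀ b, (fam b).card ≤ (F0 + 2 * F1 + F2) * len b := by
    intro b
    have e1 := Finset.card_union_le (T0 b)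
      ((T1 b).image (app (j + 1) (s * b + s - 1)) ∪ ((T1 b).image (pre (s * b - 1)) ∪
        (T2 b).image (fun p => pre (s * b - 1) (app j (s * b + s - 1) p))))
    have e2 := Finset.card_union_le ((T1 b).image (app (j + 1) (s * b + s - 1)))
      ((T1 b).image (pre (s * b - 1)) ∪
        (T2 b).image (fun p => pre (s * b - 1) (app j (s * b + s - 1) p)))
    have e3 := Finset.card_union_le ((T1 b).image (pre (s * b - 1)))
      ((T2 b).image (fun p => pre (s * b - 1) (app j (s * b + s - 1) p)))
    have e4 : ((T1 b).image (app (j + 1) (s * b + s - 1))).card ≤ _ := Finset.card_image_le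
    have e5 : ((T1 b).image (pre (s * b - 1))).card ≤ _ := Finset.card_image_le
    have e6 : ((T2 b).image (fun p => pre (s * b - 1) (app j (s * b + s - 1) p))).card ≤ _ :=
      Finset.card_image_le
    have := hT0 b
    have := hT1 b
    have := hT2 b
    have e7 : (F0 + 2 * F1 + F2) * len b = F0 * len b + 2 * (F1 * len b) + F2 * len b := by ring
    rw [e7]
    simp only [fam]
    omega
  refine ⟨(Finset.range (n / s + 1)).biUnion fam ∪ T3.image (fun p i => s * (p i + 1) - 1),
    ?_, ?_⟩
  · refine (Finset.card_union_le _ _).trans (add_le_add ?_ (Finset.card_image_le.trans hT3))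
    refine Finset.card_biUnion_le.trans ((Finset.sum_le_sum fun b _ => hfam b).trans ?_)
    rw [← Finset.mul_sum, hsum]
  intro S hS hc
  set B := S.image (fun i => i / s) with hB
  let blk : ℕ → Finset ℕ := fun b => S.filter (fun i => i / s = b)
  have hblk_sub : ∀ b, blk b ⊆ S := fun b => Finset.filter_subset _ _
  have hblk : ∀ b, ∀ i ∈ blk b, s * b ≤ i ∧ i < s * b + len b := by
    intro b i hi
    obtain ⟨hiS, rfl⟩ := Finset.mem_filter.1 hi
    have hin := hS i hiS
    have e1 := Nat.div_add_mod i s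
    have e2 := Nat.mod_lt i hs
    refine ⟨by omega, ?_⟩
    dsimp only [len]
    split_ifs with h
    · omega
    · have e3 : i / s = n / s := le_antisymm (Nat.div_le_div_right hin.le) (not_lt.1 h)
      have e4 := Nat.div_add_mod n s
      rw [e3] at e1 ⊢
      omega
  have hblk_end : ∀ b, ∀ i ∈ blk b, i ≤ s * b + s - 1 := by
    intro b i hi
    have := hblk b i hi
    have := hlen b
    omega
  have hBmem : ∀ b ∈ B, b < n / s + 1 := by
    intro b hb
    obtain ⟨i, hi, rfl⟩ := Finset.mem_image.1 hb
    exact Nat.lt_succ_of_le (Nat.div_le_div_right (hS i hi).le)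
  have hfam_mem : ∀ b ∈ B, ∀ p ∈ fam b, p ∈ (Finset.range (n / s + 1)).biUnion fam ∪
      T3.image (fun p i => s * (p i + 1) - 1) := fun b hb p hp =>
    Finset.mem_union_left _ (Finset.mem_biUnion.2 ⟨b, Finset.mem_range.2 (hBmem b hb), hp⟩)
  have hne : B.Nonempty := (Finset.card_pos.1 (by omega : 0 < S.card)).image _
  set lo := B.min' hne with hlo
  set hi := B.max' hne with hhi
  have hloB : lo ∈ B := Finset.min'_mem _ _
  have hhiB : hi ∈ B := Finset.max'_mem _ _
  have after : ∀ b, b < hi → ∃ z ∈ S, s * b + s - 1 < z := by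
    intro b hb
    obtain ⟨z, hz, e⟩ := Finset.mem_image.1 hhiB
    refine ⟨z, hz, ?_⟩
    have h1 : (b + 1) * s ≤ z := (Nat.le_div_iff_mul_le hs).1 (by omega)
    have h2 : (b + 1) * s = s * b + s := by ring
    omega
  have before : ∀ b, lo < b → ∃ z ∈ S, z ≤ s * b - 1 := by
    intro b hb
    obtain ⟨z, hz, e⟩ := Finset.mem_image.1 hloB
    refine ⟨z, hz, ?_⟩
    have h1 : z < b * s := (Nat.div_lt_iff_lt_mul hs).1 (by omega)
    have h2 : b * s = s * b := by ring
    omega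
  have start : ∀ b, lo < b → ∀ i ∈ blk b, s * b - 1 < i := by
    intro b hb i hi
    have h1 := (hblk b i hi).1
    have h2 : 0 < s * b := Nat.mul_pos hs (by omega)
    omega
  rcases eq_or_lt_of_le (Finset.min'_le_max' B hne : lo ≤ hi) with heq | hlt
  · have hSb : blk lo = S := by
      refine Finset.filter_true_of_mem fun i hiS => ?_
      have h1 : i / s ∈ B := Finset.mem_image_of_mem _ hiS
      have h2 : lo ≤ i / s := Finset.min'_le _ _ h1
      have h3 : i / s ≤ hi := Finset.le_max' _ _ h1
      omega
    obtain ⟨p, hp, hst⟩ := hS0 lo (blk lo) (hblk lo) (by rwa [hSb])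
    exact ⟨p, hfam_mem lo hloB p (Finset.mem_union_left _ hp), hst.mono (hblk_sub lo)⟩
  by_cases c1 : k1 < (blk lo).card
  · obtain ⟨p, hp, hst⟩ := hS1 lo (blk lo) (hblk lo) c1
    obtain ⟨z, hz, hvz⟩ := after lo hlt
    exact ⟨_, hfam_mem lo hloB _ (Finset.mem_union_right _ (Finset.mem_union_left _
      (Finset.mem_image_of_mem _ hp))), hst.append (hblk_sub lo) (hblk_end lo) hz hvz⟩
  by_cases c2 : k1 < (blk hi).card
  · obtain ⟨p, hp, hst⟩ := hS1 hi (blk hi) (hblk hi) c2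
    obtain ⟨z, hz, hvz⟩ := before hi hlt
    exact ⟨_, hfam_mem hi hhiB _ (Finset.mem_union_right _ (Finset.mem_union_right _
      (Finset.mem_union_left _ (Finset.mem_image_of_mem _ hp)))),
      hst.prepend (hblk_sub hi) (start hi hlt) hz hvz⟩
  by_cases c3 : ∃ b ∈ B, b ≠ lo ∧ b ≠ hi ∧ k2 < (blk b).card
  · obtain ⟨b, hb, hblo, hbhi, hcb⟩ := c3
    have hlb : lo < b := lt_of_le_of_ne (Finset.min'_le _ _ hb) (Ne.symm hblo)
    have hbh : b < hi := lt_of_le_of_ne (Finset.le_max' _ _ hb) hbhi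
    obtain ⟨p, hp, hst⟩ := hS2 b (blk b) (hblk b) hcb
    obtain ⟨z, hz, hvz⟩ := after b hbh
    obtain ⟨z', hz', hvz'⟩ := before b hlb
    have hst1 := hst.append (Finset.subset_insert z _) (hblk_end b)
      (Finset.mem_insert_self z _) hvz
    have hst2 := hst1.prepend (Finset.insert_subset hz (hblk_sub b)) (v := s * b - 1) (z := z')
      (by
        intro i hi
        rcases Finset.mem_insert.1 hi with rfl | hi
        · omega
        · exact start b hlb i hi) hz' hvz'
    exact ⟨_, hfam_mem b hb _ (Finset.mem_union_right _ (Finset.mem_union_right _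
      (Finset.mem_union_right _ (Finset.mem_image_of_mem _ hp)))), hst2⟩
  push Not at c3
  have hBc : k3 < B.card := by
    by_contra hcon
    have e1 : S.card = ∑ b ∈ B, (blk b).card := Finset.card_eq_sum_card_image _ _
    have e2 : ∑ b ∈ B, (blk b).card ≤
        ∑ b ∈ B, (k2 + ((if b = lo then k1 else 0) + (if b = hi then k1 else 0))) := by
      refine Finset.sum_le_sum fun b hb => ?_
      by_cases hb1 : b = lo
      · subst hb1
        simp only [if_true]
        omega
      by_cases hb2 : b = hi
      · subst hb2
        simp only [if_true]
        omega
      have := c3 b hb hb1 hb2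
      omega
    rw [Finset.sum_add_distrib, Finset.sum_add_distrib, Finset.sum_ite_eq' B lo,
      Finset.sum_ite_eq' B hi, if_pos hloB, if_pos hhiB, Finset.sum_const, smul_eq_mul] at e2
    have e3 : B.card * k2 ≤ k3 * k2 := Nat.mul_le_mul_right _ (not_lt.1 hcon)
    omega
  obtain ⟨p, hp, hst⟩ := hS3 B hBmem hBc
  exact ⟨_, Finset.mem_union_right _ (Finset.mem_image_of_mem _ hp), hst.of_blocks hs⟩

lemma ackH_one (x : ℕ) : ackH 1 x = 2 ^ x := by
  induction x with
  | zero => simp [ackH]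
  | succ x ih => rw [ackH, ih, ackH, pow_succ, mul_comm]

lemma ackH_at_one (m : ℕ) : ackH m 1 = 2 := by
  induction m with
  | zero => simp [ackH]
  | succ m ih => rw [ackH, ackH, ih]

lemma two_pow_le_ackH (m x : ℕ) : 2 ^ x ≤ ackH (m + 1) x := by
  induction m generalizing x with
  | zero => exact (ackH_one x).ge
  | succ m ih =>
    induction x with
    | zero => simp [ackH]
    | succ x ihx =>
      rw [ackH]
      refine le_trans ?_ (ih _)
      exact Nat.pow_le_pow_right (by norm_num) ((Nat.lt_two_pow_self).trans_le ihx)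

lemma two_pow_ackH_le (m x : ℕ) : 2 ^ ackH (m + 2) x ≤ ackH (m + 2) (x + 1) := by
  rw [ackH]
  exact two_pow_le_ackH m _

lemma ackH_pos (m x : ℕ) : 1 ≤ ackH (m + 1) x :=
  Nat.one_le_two_pow.trans (two_pow_le_ackH m x)

lemma pow_mul_ackH_le (m x u : ℕ) : 2 ^ u * ackH (m + 2) x ≤ ackH (m + 2) (x + u) := by
  induction u with
  | zero => simp
  | succ u ih =>
    have h1 := two_pow_ackH_le m (x + u)
    have h2 : 2 * ackH (m + 2) (x + u) ≤ 2 ^ ackH (m + 2) (x + u) := by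
      obtain ⟨v, hv⟩ := Nat.exists_eq_add_of_le' (ackH_pos (m + 1) (x + u))
      rw [show m + 1 + 1 = m + 2 from rfl] at hv
      rw [hv, pow_succ, mul_comm]
      exact Nat.mul_le_mul_right _ Nat.lt_two_pow_self
    calc 2 ^ (u + 1) * ackH (m + 2) x = 2 * (2 ^ u * ackH (m + 2) x) := by ring
      _ ≤ 2 * ackH (m + 2) (x + u) := Nat.mul_le_mul_left _ ih
      _ ≤ _ := h2.trans h1

/-- A polynomial in `A_k(x)` is at most a bounded number of steps away in the argument. -/
lemma two_pow_mul_ackH_pow_le (m x h q : ℕ) :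
    2 ^ h * ackH (m + 2) x ^ q ≤ ackH (m + 2) (x + 1 + (h + q)) := by
  have hy := ackH_pos (m + 1) x
  rw [show m + 1 + 1 = m + 2 from rfl] at hy
  calc 2 ^ h * ackH (m + 2) x ^ q ≤ 2 ^ h * (2 ^ ackH (m + 2) x) ^ q :=
        Nat.mul_le_mul_left _ (Nat.pow_le_pow_left Nat.lt_two_pow_self.le _)
    _ = 2 ^ (h + ackH (m + 2) x * q) := by rw [← pow_mul, ← pow_add]
    _ ≤ 2 ^ ackH (m + 2) (x + (h + q)) := by
        refine Nat.pow_le_pow_right (by norm_num) (le_trans ?_ (pow_mul_ackH_le m x (h + q)))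
        calc h + ackH (m + 2) x * q ≤ h * ackH (m + 2) x + ackH (m + 2) x * q := by
              gcongr
              exact Nat.le_mul_of_pos_right _ hy
          _ = (h + q) * ackH (m + 2) x := by ring
          _ ≤ _ := Nat.mul_le_mul_right _ Nat.lt_two_pow_self.le
    _ ≤ ackH (m + 2) (x + (h + q) + 1) := two_pow_ackH_le m _
    _ = _ := by congr 1; ring

lemma exists_mul_pow_le_two_pow (a b D : ℕ) : ∃ h₀ : ℕ, ∀ h ≥ h₀, a * (h + b) ^ D ≤ 2 ^ h := by
  have h1 := tendsto_pow_const_div_const_pow_of_one_lt D (r := (2 : ℝ)) (by norm_num)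
  have h2 : ∀ᶠ n : ℕ in Filter.atTop, (n : ℝ) ^ D / 2 ^ n < 1 / (a * 2 ^ b + 1) :=
    h1.eventually_lt_const (by positivity)
  obtain ⟨N, hN⟩ := Filter.eventually_atTop.1 h2
  refine ⟨N, fun h hh => ?_⟩
  have h3 := hN (h + b) (by omega)
  rw [div_lt_div_iff₀ (by positivity) (by positivity)] at h3
  have h4 : (a : ℝ) * ((h + b : ℕ) : ℝ) ^ D * 2 ^ b ≤ 2 ^ h * 2 ^ b := by
    rw [← pow_add]
    have : (0 : ℝ) ≤ ((h + b : ℕ) : ℝ) ^ D := by positivity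
    linarith
  have h5 := le_of_mul_le_mul_right h4 (by positivity)
  exact_mod_cast h5

lemma exists_hasStab_log (j : ℕ) :
    ∃ B, 1 ≤ B ∧ ∀ x n, n ≤ 2 ^ x → HasStab (j + 1) B n ((4 * (x + 1)) ^ (j + 1) * n) := by
  induction j using Nat.strong_induction_on with
  | _ j ih =>
  obtain rfl | rfl | ⟨j, rfl⟩ : j = 0 ∨ j = 1 ∨ ∃ i, j = i + 2 := by
    rcases j with _ | _ | j
    · exact Or.inl rfl
    · exact Or.inr (Or.inl rfl)
    · exact Or.inr (Or.inr ⟨j, rfl⟩)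
  · refine ⟨1, le_rfl, fun x n _ => (hasStab_one n).mono le_rfl le_rfl ?_⟩
    exact Nat.le_mul_of_pos_left _ (by positivity)
  · refine ⟨2, by norm_num, fun x n _ => (hasStab_two n).mono le_rfl le_rfl ?_⟩
    exact Nat.le_mul_of_pos_left _ (by positivity)
  obtain ⟨B2, hB2, h2⟩ := ih j (by omega)
  obtain ⟨B1, hB1, h1⟩ := ih (j + 1) (by omega)
  refine ⟨3 * B2 + 2 * B1, by omega, fun x => ?_⟩
  induction x with
  | zero =>
    intro n hn
    exact hasStab_of_le (by omega)
  | succ x ihx =>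
    intro n hn
    have hdiv : n / 2 ^ x + 1 ≤ 3 := by
      have : n / 2 ^ x ≤ 2 := by
        refine Nat.div_le_of_le_mul ?_
        rwa [← pow_succ]
      omega
    have hb := HasStab.block (j := j + 1) (s := 2 ^ x) (n := n) (by positivity)
      (fun l hl => ihx l hl) (fun l hl => h1 x l hl) (fun l hl => h2 x l hl)
      (hasStab_of_le (k := 3) (M := 0) hdiv) le_rfl
    refine hb.mono le_rfl le_rfl ?_
    rw [add_zero]
    refine Nat.mul_le_mul_right _ ?_
    set z := 4 * (x + 1) with hz
    have hz' : 4 * (x + 1 + 1) = z + 4 := by omega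
    rw [hz']
    have e1 : z ^ (j + 1) ≤ (z + 4) ^ (j + 1) := Nat.pow_le_pow_left (by omega) _
    have hz4 : 4 ≤ z := by omega
    calc z ^ (j + 2 + 1) + 2 * z ^ (j + 1 + 1) + z ^ (j + 1)
        = z ^ (j + 1) * (z ^ 2 + 2 * z + 1) := by ring
      _ ≤ (z + 4) ^ (j + 1) * (z + 4) ^ 2 := Nat.mul_le_mul e1 (by nlinarith)
      _ = _ := by ring

/-- Chains of length `P m` are stabbed by `O(n · A_{m+1}^{-1}(n)^q)` tuples, with constants
independent of `m`. -/
def GoodSeq (j : ℕ) (P : ℕ → ℕ) : Prop :=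
  ∃ c q : ℕ, 1 ≤ c ∧ 1 ≤ q ∧ ∀ m ≥ 1, ∀ x ≥ 1, ∀ n ≤ c * ackH m x ^ q,
    HasStab j (P m) n (c * x ^ q * n)

lemma GoodSeq.mono {j : ℕ} {P P' : ℕ → ℕ} (h : GoodSeq j P) (hP : ∀ m, P m ≤ P' m) :
    GoodSeq j P' := by
  obtain ⟨c, q, hc, hq, h⟩ := h
  exact ⟨c, q, hc, hq, fun m hm x hx n hn => (h m hm x hx n hn).mono (hP m) le_rfl le_rfl⟩

lemma goodSeq_one : GoodSeq 1 (fun _ => 1) :=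
  ⟨1, 1, le_rfl, le_rfl, fun _ _ x hx n _ => (hasStab_one n).mono le_rfl le_rfl
    (Nat.le_mul_of_pos_left _ (by positivity))⟩

lemma goodSeq_two : GoodSeq 2 (fun _ => 2) :=
  ⟨1, 1, le_rfl, le_rfl, fun _ _ x hx n _ => (hasStab_two n).mono le_rfl le_rfl
    (Nat.le_mul_of_pos_left _ (by positivity))⟩

lemma GoodSeq.hasStab_of_le {j : ℕ} {P : ℕ → ℕ} (h : GoodSeq j P) :
    ∃ c q : ℕ, ∀ m ≥ 1, ∀ x ≥ 1, ∀ n ≤ ackH m x, HasStab j (P m) n (c * x ^ q * n) := by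
  obtain ⟨c, q, hc, hq, h⟩ := h
  refine ⟨c, q, fun m hm x hx n hn => h m hm x hx n (hn.trans ?_)⟩
  exact (Nat.le_self_pow (by omega) _).trans (Nat.le_mul_of_pos_left _ (by omega))

/-- The recursion on the chain lengths; `B` depends only on `j`. -/
lemma exists_goodSeq_step (j : ℕ) : ∃ B : ℕ, ∀ P P1 P2 : ℕ → ℕ,
    GoodSeq (j + 1) P2 → GoodSeq (j + 2) P1 → (∀ m, B ≤ P m) → (∀ m, P m ≤ P (m + 1)) →
    (∀ m, P m * P2 (m + 1) + 2 * P1 (m + 1) ≤ P (m + 1)) → GoodSeq (j + 3) P := by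
  obtain ⟨B, -, hB⟩ := exists_hasStab_log (j + 2)
  refine ⟨B, fun P P1 P2 g2 g1 hPB hPm hP => ?_⟩
  obtain ⟨c1, q1, g1⟩ := g1.hasStab_of_le
  obtain ⟨c2, q2, g2⟩ := g2.hasStab_of_le
  set Q := q1 + q2 + (j + 3) with hQ
  set q := Q + 1 with hq
  obtain ⟨h₀, hh₀⟩ := exists_mul_pow_le_two_pow (4 ^ (j + 3) + (2 * c1 + c2 + 2)) (q + 1) Q
  set h := h₀ + 1 with hh
  have hbig := hh₀ h (by omega)
  have hA : (4 * (h + q + 1)) ^ (j + 3) ≤ 2 ^ h := by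
    refine le_trans ?_ hbig
    rw [mul_pow]
    refine Nat.mul_le_mul (by omega) ?_
    exact Nat.pow_le_pow_right (by omega) (by omega)
  have hD : (2 * c1 + c2 + 2) * (h + (q + 1)) ^ Q ≤ 2 ^ h :=
    le_trans (Nat.mul_le_mul_right _ (Nat.le_add_left _ _)) hbig
  refine ⟨2 ^ h, q, Nat.one_le_two_pow, by omega, fun m hm => ?_⟩
  induction m, hm using Nat.le_induction with
  | base =>
    intro x hx n hn
    rw [ackH_one, ← pow_mul, ← pow_add] at hn
    refine (hB _ n hn).mono (hPB 1) le_rfl (Nat.mul_le_mul_right _ ?_)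
    calc (4 * (h + x * q + 1)) ^ (j + 2 + 1) ≤ (4 * (h + q + 1) * x) ^ (j + 3) := by
          refine Nat.pow_le_pow_left ?_ _
          nlinarith
      _ = (4 * (h + q + 1)) ^ (j + 3) * x ^ (j + 3) := mul_pow _ _ _
      _ ≤ _ := Nat.mul_le_mul hA (Nat.pow_le_pow_right hx (by omega))
  | succ m hm ih =>
    obtain ⟨m, rfl⟩ := Nat.exists_eq_add_of_le' hm
    intro x hx
    induction x, hx using Nat.le_induction with
    | base =>
      intro n hn
      refine (ih 1 le_rfl n ?_).mono (hPm _) le_rfl le_rfl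
      rwa [ackH_at_one] at hn ⊢
    | succ x hx ihx =>
      intro n hn
      set y := ackH (m + 1 + 1) x with hy
      have hy1 : 1 ≤ y := ackH_pos _ _
      set s := 2 ^ h * y ^ q with hs
      have hs2 : 2 ≤ s := by
        have e1 : 2 ^ 1 ≤ 2 ^ h := Nat.pow_le_pow_right (by norm_num) (by omega)
        have e2 : 1 ≤ y ^ q := Nat.one_le_pow _ _ hy1
        calc 2 = 2 ^ 1 * 1 := by norm_num
          _ ≤ s := Nat.mul_le_mul e1 e2
      rcases le_or_gt n s with hns | hns
      · refine (ihx n hns).mono le_rfl le_rfl ?_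
        gcongr
        omega
      have hsA : s ≤ ackH (m + 1 + 1) (x + 1 + (h + q)) := two_pow_mul_ackH_pow_le m x h q
      have hdiv : n / s + 1 ≤ n := by
        have : n / s < n := Nat.div_lt_self (by omega) hs2
        omega
      have hb := HasStab.block (j := j + 1) (s := s) (n := n) (by omega)
        (fun l hl => ihx l hl)
        (fun l hl => g1 (m + 1 + 1) (by omega) (x + 1 + (h + q)) (by omega) l (hl.trans hsA))
        (fun l hl => g2 (m + 1 + 1) (by omega) (x + 1 + (h + q)) (by omega) l (hl.trans hsA))
        (ih y hy1 (n / s + 1) (hdiv.trans (by rwa [ackH] at hn))) (hP (m + 1))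
      refine hb.mono le_rfl le_rfl ?_
      have hM3 : 2 ^ h * y ^ q * (n / s + 1) ≤ 2 * n := by
        rw [← hs, mul_add, mul_one]
        have := Nat.mul_div_le n s
        omega
      have hx1 : x + 1 + (h + q) ≤ (x + 1) * (h + (q + 1)) := by nlinarith
      have hpow : ∀ e ≤ Q, (x + 1 + (h + q)) ^ e ≤ (x + 1) ^ Q * (h + (q + 1)) ^ Q := by
        intro e he
        calc (x + 1 + (h + q)) ^ e ≤ ((x + 1) * (h + (q + 1))) ^ e := Nat.pow_le_pow_left hx1 _
          _ ≤ ((x + 1) * (h + (q + 1))) ^ Q := Nat.pow_le_pow_right (by positivity) he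
          _ = _ := mul_pow _ _ _
      have p1 := hpow q1 (by omega)
      have p2 := hpow q2 (by omega)
      have p0 := hpow 0 (by omega)
      rw [pow_zero] at p0
      set W := (x + 1) ^ Q * (h + (q + 1)) ^ Q with hW
      have hWle : (2 * c1 + c2 + 2) * W ≤ 2 ^ h * (x + 1) ^ Q := by
        calc (2 * c1 + c2 + 2) * W = (x + 1) ^ Q * ((2 * c1 + c2 + 2) * (h + (q + 1)) ^ Q) := by
              rw [hW]; ring
          _ ≤ (x + 1) ^ Q * 2 ^ h := Nat.mul_le_mul_left _ hD
          _ = _ := mul_comm _ _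
      have hxq : x ^ q + (x + 1) ^ Q ≤ (x + 1) ^ q := by
        rw [hq, pow_succ, pow_succ]
        have : x ^ Q ≤ (x + 1) ^ Q := Nat.pow_le_pow_left (by omega) _
        nlinarith
      have hfin : 2 ^ h * x ^ q + 2 * (c1 * (x + 1 + (h + q)) ^ q1) +
          c2 * (x + 1 + (h + q)) ^ q2 + 2 ≤ 2 ^ h * (x + 1) ^ q := by
        calc _ ≤ 2 ^ h * x ^ q + 2 * (c1 * W) + c2 * W + 2 * W := by gcongr; omega
          _ = 2 ^ h * x ^ q + (2 * c1 + c2 + 2) * W := by ring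
          _ ≤ 2 ^ h * x ^ q + 2 ^ h * (x + 1) ^ Q := by gcongr
          _ = 2 ^ h * (x ^ q + (x + 1) ^ Q) := by ring
          _ ≤ _ := Nat.mul_le_mul_left _ hxq
      calc _ ≤ (2 ^ h * x ^ q + 2 * (c1 * (x + 1 + (h + q)) ^ q1) +
          c2 * (x + 1 + (h + q)) ^ q2) * n + 2 * n := Nat.add_le_add_left hM3 _
        _ = (2 ^ h * x ^ q + 2 * (c1 * (x + 1 + (h + q)) ^ q1) +
          c2 * (x + 1 + (h + q)) ^ q2 + 2) * n := by ring
        _ ≤ _ := Nat.mul_le_mul_right _ hfin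

lemma two_pow_le_stretchK (d n i : ℕ) : 2 ^ d ≤ stretchK d n i := by
  induction i with
  | zero => exact le_rfl
  | succ i ih =>
    rw [stretchK]
    refine le_mul_of_one_le_right (by positivity) (one_le_pow₀ ?_)
    exact (one_le_pow₀ (by norm_num)).trans ih

lemma one_le_stretchK (d n i : ℕ) : 1 ≤ stretchK d n i :=
  (one_le_pow₀ (by norm_num)).trans (two_pow_le_stretchK d n i)

lemma stretchK_pow_le {d n : ℕ} (hn : 2 ≤ n) {i m : ℕ} (him : i < m) :
    2 ^ d * stretchK d n i ^ (n - 1) ≤ stretchK d n m := by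
  induction m, him using Nat.le_induction with
  | base => exact le_rfl
  | succ m _ ih =>
    refine ih.trans ?_
    rw [stretchK]
    calc stretchK d n m ≤ stretchK d n m ^ (n - 1) :=
          le_self_pow₀ (one_le_stretchK d n m) (by omega)
      _ ≤ _ := le_mul_of_one_le_left (pow_nonneg (by linarith [one_le_stretchK d n m]) _)
          (one_le_pow₀ (by norm_num))

/-- A point whose coordinates interleave, with some room, with the indices of `m + 1` diagonal
points agrees in the first `m` coordinates with a convex combination of these points. -/
lemma exists_convex_weights {d n : ℕ} (hn : 2 ≤ n) {x : ℕ → ℕ} (m : ℕ) (hmd : m ≤ d)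
    (hx : ∀ i ≤ m, x i ≤ n - 1) (hmono : ∀ i < m, x i ≤ x (i + 1)) (p : ℕ → ℝ)
    (hp : ∀ i < m, stretchK d n i ^ x i + m ≤ p i ∧
      stretchK d n i * p i * 2 ^ m ≤ 2 ^ d * stretchK d n i ^ x (i + 1)) :
    ∃ w : ℕ → ℝ, (∀ j, 0 ≤ w j) ∧ ∑ j ∈ Finset.range (m + 1), w j = 1 ∧
      ∀ i < m, ∑ j ∈ Finset.range (m + 1), w j * stretchK d n i ^ x j = p i := by
  induction m generalizing p with
  | zero => exact ⟨fun _ => 1, fun _ => zero_le_one, by simp, fun i hi => absurd hi (by omega)⟩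
  | succ m ih =>
    set K := stretchK d n with hKdef
    have hK1 : ∀ i, 1 ≤ K i := one_le_stretchK d n
    have hKpos : ∀ i, 0 < K i := fun i => by linarith [hK1 i]
    have ih' := ih (by omega) (fun i hi => hx i (by omega)) (fun i hi => hmono i (by omega))
    have hppos : ∀ i < m + 1, 1 ≤ p i := by
      intro i hi
      have h1 := (hp i hi).1
      have h2 : 1 ≤ K i ^ x i := one_le_pow₀ (hK1 i)
      have h3 : (0 : ℝ) ≤ ((m + 1 : ℕ) : ℝ) := Nat.cast_nonneg _
      linarith
    obtain ⟨w, hw0, hw1, hwp⟩ := ih' p (by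
      intro i hi
      obtain ⟨h1, h2⟩ := hp i (by omega)
      refine ⟨?_, ?_⟩
      · push_cast at h1
        linarith
      · refine le_trans ?_ h2
        have := hppos i (by omega)
        have := hKpos i
        rw [pow_succ]
        have h3 : 0 ≤ K i * p i * 2 ^ m := by positivity
        linarith)
    obtain ⟨hpm1, hpm2⟩ := hp m (by omega)
    set lam := p m / K m ^ x (m + 1) with hlam
    have hKx : 0 < K m ^ x (m + 1) := pow_pos (hKpos m) _
    have hlam0 : 0 ≤ lam := div_nonneg (by linarith [hppos m (by omega)]) hKx.le
    have hlamK : lam * K m * 2 ^ (m + 1) ≤ 2 ^ d := by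
      have : lam * K m * 2 ^ (m + 1) = (K m * p m * 2 ^ (m + 1)) / K m ^ x (m + 1) := by
        rw [hlam]; ring
      rw [this]
      exact (div_le_iff₀ hKx).2 hpm2
    have h2m : (2 : ℝ) ≤ 2 ^ (m + 1) := le_self_pow₀ (by norm_num) (by omega)
    have hlam_half : lam ≤ 1 / 2 := by
      have h1 : lam * 2 ^ d * 2 ≤ 2 ^ d := by
        refine le_trans ?_ hlamK
        have := two_pow_le_stretchK d n m
        have := mul_nonneg hlam0 (hKpos m).le
        gcongr
      have h2 : (0 : ℝ) < 2 ^ d := by positivity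
      nlinarith
    have hlam_small : ∀ i < m, lam * K i ^ x (m + 1) ≤ 1 := by
      intro i hi
      have h1 : 2 ^ d * K i ^ (n - 1) ≤ K m := stretchK_pow_le hn hi
      have h2 : K i ^ x (m + 1) ≤ K i ^ (n - 1) := pow_le_pow_right₀ (hK1 i) (hx _ le_rfl)
      have h3 : lam * (2 ^ d * K i ^ x (m + 1)) * 1 ≤ 2 ^ d := by
        refine le_trans ?_ hlamK
        have h4 : 2 ^ d * K i ^ x (m + 1) ≤ K m := le_trans (by gcongr) h1
        have h5 : (1 : ℝ) ≤ 2 ^ (m + 1) := by linarith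
        have := hKpos m
        gcongr
      have h6 : (0 : ℝ) < 2 ^ d := by positivity
      have h7 : 2 ^ d * (lam * K i ^ x (m + 1)) ≤ 2 ^ d * 1 := by linarith
      exact le_of_mul_le_mul_left h7 h6
    have h1lam : 0 < 1 - lam := by linarith
    obtain ⟨v, hv0, hv1, hvp⟩ := ih' (fun i => (p i - lam * K i ^ x (m + 1)) / (1 - lam)) (by
      intro i hi
      obtain ⟨h1, h2⟩ := hp i (by omega)
      have h3 := hlam_small i hi
      have h4 := hppos i (by omega)
      have h5 : 0 ≤ lam * K i ^ x (m + 1) := mul_nonneg hlam0 (pow_nonneg (hKpos i).le _)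
      refine ⟨?_, ?_⟩
      · rw [le_div_iff₀ h1lam]
        push_cast at h1
        have h6 : 0 ≤ K i ^ x i + m := by
          have := pow_pos (hKpos i) (x i)
          positivity
        nlinarith
      · refine le_trans ?_ h2
        have h6 : (p i - lam * K i ^ x (m + 1)) / (1 - lam) ≤ 2 * p i := by
          rw [div_le_iff₀ h1lam]
          nlinarith
        calc K i * ((p i - lam * K i ^ x (m + 1)) / (1 - lam)) * 2 ^ m
            ≤ K i * (2 * p i) * 2 ^ m := by
              have := hKpos i
              gcongr
          _ = _ := by ring)
    have hxm : ∀ j ≤ m, x j ≤ x m := by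
      intro j hj
      have key : ∀ k, j + k ≤ m → x j ≤ x (j + k) := by
        intro k
        induction k with
        | zero => exact fun _ => le_rfl
        | succ k ihk => exact fun hk => (ihk (by omega)).trans (hmono (j + k) (by omega))
      simpa [Nat.add_sub_cancel' hj] using key (m - j) (by omega)
    set lo := ∑ j ∈ Finset.range (m + 1), w j * K m ^ x j with hlo
    set hi := (1 - lam) * ∑ j ∈ Finset.range (m + 1), v j * K m ^ x j + p m with hhi
    have hlo_le : lo ≤ p m := by
      have h1 : lo ≤ ∑ j ∈ Finset.range (m + 1), w j * K m ^ x m := by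
        refine Finset.sum_le_sum fun j hj => mul_le_mul_of_nonneg_left ?_ (hw0 j)
        exact pow_le_pow_right₀ (hK1 m) (hxm j (Nat.lt_succ_iff.1 (Finset.mem_range.1 hj)))
      rw [← Finset.sum_mul, hw1, one_mul] at h1
      have h3 : (0 : ℝ) ≤ ((m + 1 : ℕ) : ℝ) := Nat.cast_nonneg _
      linarith
    have hle_hi : p m ≤ hi := by
      have : 0 ≤ ∑ j ∈ Finset.range (m + 1), v j * K m ^ x j :=
        Finset.sum_nonneg fun j _ => mul_nonneg (hv0 j) (pow_nonneg (hKpos m).le _)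
      have := mul_nonneg h1lam.le this
      linarith
    obtain ⟨a, b, ha, hb, hab, hpab⟩ := Icc_subset_segment (𝕜 := ℝ) ⟨hlo_le, hle_hi⟩
    simp only [smul_eq_mul] at hpab
    let W : ℕ → ℝ := fun j => if j < m + 1 then a * w j + b * ((1 - lam) * v j) else b * lam
    have hWsum : ∀ g : ℕ → ℝ, ∑ j ∈ Finset.range (m + 1 + 1), W j * g j =
        a * ∑ j ∈ Finset.range (m + 1), w j * g j +
          b * ((1 - lam) * ∑ j ∈ Finset.range (m + 1), v j * g j + lam * g (m + 1)) := by
      intro g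
      rw [Finset.sum_range_succ, Finset.sum_congr rfl
        (g := fun j => a * (w j * g j) + b * ((1 - lam) * (v j * g j)))]
      · simp only [W, lt_irrefl, if_false]
        rw [Finset.sum_add_distrib, ← Finset.mul_sum, ← Finset.mul_sum, ← Finset.mul_sum]
        ring
      · intro j hj
        simp only [W, Finset.mem_range.1 hj, if_true]
        ring
    refine ⟨W, ?_, ?_, ?_⟩
    · intro j
      have := hw0 j
      have := hv0 j
      dsimp only [W]
      split_ifs <;> positivity
    · have := hWsum (fun _ => 1)
      simp only [mul_one] at this
      rw [this, hw1, hv1]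
      linear_combination hab
    · intro i hi'
      rw [hWsum (fun j => K i ^ x j)]
      rcases Nat.lt_succ_iff_lt_or_eq.1 hi' with h | rfl
      · rw [hwp i h, hvp i h, mul_div_cancel₀ _ h1lam.ne']
        linear_combination p i * hab
      · rw [← hlo, hlam, div_mul_cancel₀ _ hKx.ne', ← hlam, ← hhi]
        exact hpab

/-- The point with coordinates `K_{i+1} ^ (e i)` lies in every convex set containing diagonal points
whose indices strictly interleave with `e`. -/
lemma mem_of_interleave {d n : ℕ} (hn : 2 ≤ n) {C : Set (Fin d → ℝ)} (hC : Convex ℝ C)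
    {x e : ℕ → ℕ} (hx : ∀ i ≤ d, x i < n)
    (hxC : ∀ i ≤ d, (fun l : Fin d => stretchK d n l ^ x i) ∈ C)
    (he : ∀ i < d, x i < e i ∧ e i < x (i + 1)) :
    (fun l : Fin d => stretchK d n l ^ e l) ∈ C := by
  obtain ⟨w, hw0, hw1, hwp⟩ := exists_convex_weights (d := d) hn (x := x) d le_rfl
    (fun i hi => by have := hx i hi; omega) (fun i hi => by have := he i hi; omega)
    (fun i => stretchK d n i ^ e i) (by
      intro i hi
      obtain ⟨h1, h2⟩ := he i hi
      have hK := one_le_stretchK d n i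
      have hK2 := two_pow_le_stretchK d n i
      refine ⟨?_, ?_⟩
      · have e1 : stretchK d n i ^ (x i + 1) ≤ stretchK d n i ^ e i := pow_le_pow_right₀ hK h1
        have e2 : (d : ℝ) + 1 ≤ 2 ^ d := by exact_mod_cast Nat.lt_two_pow_self (n := d)
        have e3 : 1 ≤ stretchK d n i ^ x i := one_le_pow₀ hK
        rw [pow_succ] at e1
        have e4 : (d : ℝ) ≥ 0 := Nat.cast_nonneg d
        nlinarith
      · have e1 : stretchK d n i ^ (e i + 1) ≤ stretchK d n i ^ x (i + 1) :=
          pow_le_pow_right₀ hK h2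
        rw [pow_succ] at e1
        have e2 : (0 : ℝ) < 2 ^ d := by positivity
        nlinarith)
  have hmem := hC.sum_mem (t := Finset.range (d + 1)) (w := w)
    (z := fun j => (fun l : Fin d => stretchK d n l ^ x j)) (fun j _ => hw0 j) hw1
    (fun j hj => hxC j (Nat.lt_succ_iff.1 (Finset.mem_range.1 hj)))
  convert hmem using 1
  funext l
  rw [Finset.sum_apply]
  simp only [Pi.smul_apply, smul_eq_mul]
  exact (hwp l l.2).symm

/-- `GoodSeq` for the rounded powers `2 ^ f m`. -/
def GoodExp (j : ℕ) (f : ℕ → ℝ) : Prop := GoodSeq j (fun m => ⌈(2 : ℝ) ^ f m⌉₊)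

lemma ceil_two_rpow_le {a : ℝ} (ha : 0 ≤ a) : (⌈(2 : ℝ) ^ a⌉₊ : ℝ) ≤ 2 ^ (a + 1) := by
  have h1 : (1 : ℝ) ≤ 2 ^ a := Real.one_le_rpow (by norm_num) ha
  have h2 := Nat.ceil_lt_add_one (a := (2 : ℝ) ^ a) (by positivity)
  rw [Real.rpow_add (by norm_num), Real.rpow_one]
  linarith

lemma exists_goodExp_step (j : ℕ) : ∃ B : ℕ, ∀ f f1 f2 : ℕ → ℝ,
    GoodExp (j + 1) f2 → GoodExp (j + 2) f1 → (∀ m, (B : ℝ) ≤ f m) → (∀ m, 0 ≤ f1 m) →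
    (∀ m, 0 ≤ f2 m) → (∀ m, f m + f2 (m + 1) + 3 ≤ f (m + 1)) →
    (∀ m, f1 (m + 1) + 3 ≤ f (m + 1)) → GoodExp (j + 3) f := by
  obtain ⟨B, hB⟩ := exists_goodSeq_step j
  refine ⟨B, fun f f1 f2 g2 g1 hfB hf1 hf2 h2 h1 => hB _ _ _ g2 g1 ?_ ?_ ?_⟩
  · intro m
    have e1 : ((2 : ℝ) ^ (B : ℝ)) ≤ 2 ^ f m :=
      Real.rpow_le_rpow_of_exponent_le (by norm_num) (hfB m)
    have e2 : (B : ℝ) ≤ 2 ^ (B : ℝ) := by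
      rw [Real.rpow_natCast]
      exact_mod_cast (Nat.lt_two_pow_self (n := B)).le
    exact_mod_cast (e2.trans e1).trans (Nat.le_ceil _)
  · intro m
    refine Nat.ceil_mono (Real.rpow_le_rpow_of_exponent_le (by norm_num) ?_)
    have := h2 m
    have := hf2 (m + 1)
    linarith
  · intro m
    have hf0 : 0 ≤ f m := le_trans (Nat.cast_nonneg B) (hfB m)
    have a0 := ceil_two_rpow_le hf0
    have a1 := ceil_two_rpow_le (hf1 (m + 1))
    have a2 := ceil_two_rpow_le (hf2 (m + 1))
    have b1 : (2 : ℝ) ^ (f m + 1) * 2 ^ (f2 (m + 1) + 1) ≤ 2 ^ (f (m + 1) - 1) := by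
      rw [← Real.rpow_add (by norm_num)]
      refine Real.rpow_le_rpow_of_exponent_le (by norm_num) ?_
      have := h2 m
      linarith
    have b2 : 2 * (2 : ℝ) ^ (f1 (m + 1) + 1) ≤ 2 ^ (f (m + 1) - 1) := by
      have : 2 * (2 : ℝ) ^ (f1 (m + 1) + 1) = 2 ^ (f1 (m + 1) + 1 + 1) := by
        rw [Real.rpow_add (by norm_num) (f1 (m + 1) + 1), Real.rpow_one, mul_comm]
      rw [this]
      refine Real.rpow_le_rpow_of_exponent_le (by norm_num) ?_
      have := h1 m
      linarith
    have b3 : (2 : ℝ) ^ (f (m + 1)) = 2 ^ (f (m + 1) - 1) + 2 ^ (f (m + 1) - 1) := by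
      have : f (m + 1) = f (m + 1) - 1 + 1 := by ring
      rw [this, Real.rpow_add (by norm_num), Real.rpow_one]
      ring_nf
    have b4 : ((⌈(2 : ℝ) ^ f m⌉₊ : ℝ) * ⌈(2 : ℝ) ^ f2 (m + 1)⌉₊) ≤
        2 ^ (f m + 1) * 2 ^ (f2 (m + 1) + 1) := by gcongr
    have b5 := Nat.le_ceil ((2 : ℝ) ^ f (m + 1))
    have : ((⌈(2 : ℝ) ^ f m⌉₊ : ℝ) * ⌈(2 : ℝ) ^ f2 (m + 1)⌉₊ + 2 * ⌈(2 : ℝ) ^ f1 (m + 1)⌉₊) ≤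
        ⌈(2 : ℝ) ^ f (m + 1)⌉₊ := by linarith
    exact_mod_cast this

lemma exists_goodSeq_three : ∃ b : ℕ, GoodSeq 3 (fun m => 4 * m + b) := by
  obtain ⟨B, hB⟩ := exists_goodSeq_step 0
  refine ⟨B, hB _ _ _ goodSeq_one goodSeq_two ?_ ?_ ?_⟩ <;> intro m <;> omega

lemma exists_goodSeq_four : ∃ C : ℕ, GoodSeq 4 (fun m => 2 ^ (m + C)) := by
  obtain ⟨B, hB⟩ := exists_goodSeq_step 1
  obtain ⟨b, hb⟩ := exists_goodSeq_three
  set e := 16 + 2 * b with he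
  refine ⟨8 + e + B, ?_⟩
  have key : ∀ m, 8 * m + e + B ≤ 2 ^ (m + (8 + e + B)) := by
    intro m
    have h1 : m + 1 ≤ 2 ^ m := Nat.lt_two_pow_self
    have h2 : 8 + e + B ≤ 2 ^ (8 + e + B) := Nat.lt_two_pow_self.le
    have h3 := Nat.mul_le_mul h1 h2
    rw [pow_add]
    nlinarith
  have hg : GoodSeq (1 + 3) (fun m => 2 ^ (m + (8 + e + B)) - (8 * m + e)) := by
    refine hB _ _ _ goodSeq_two hb ?_ ?_ ?_ <;> intro m
    · have := key m
      omega
    · have h1 := key m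
      have h2 : 2 ^ (m + 1 + (8 + e + B)) = 2 * 2 ^ (m + (8 + e + B)) := by ring
      omega
    · have h1 := key m
      have h2 : 2 ^ (m + 1 + (8 + e + B)) = 2 * 2 ^ (m + (8 + e + B)) := by ring
      omega
  exact hg.mono fun m => Nat.sub_le _ _

/-- The exponent for even dimension `2 t + 2`. -/
noncomputable def evenExp (t C m : ℕ) : ℝ := (m + C : ℝ) ^ t / (t.factorial : ℝ)

/-- The exponent for odd dimension `2 t + 3`. -/
noncomputable def oddExp (t C D m : ℕ) : ℝ :=
  (m + C : ℝ) ^ t / (t.factorial : ℝ) * (Real.logb 2 (m + C) + D)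

lemma evenExp_nonneg (t C m : ℕ) : 0 ≤ evenExp t C m := by
  unfold evenExp; positivity

lemma logb_two_nonneg {x : ℝ} (hx : 1 ≤ x) : 0 ≤ Real.logb 2 x :=
  Real.logb_nonneg (by norm_num) hx

lemma oddExp_nonneg (t D m : ℕ) {C : ℕ} (hC : 1 ≤ C) : 0 ≤ oddExp t C D m := by
  have h1 : (1 : ℝ) ≤ m + C := by
    have : (1 : ℝ) ≤ C := by exact_mod_cast hC
    have : (0 : ℝ) ≤ m := Nat.cast_nonneg m
    linarith
  have := logb_two_nonneg h1
  unfold oddExp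
  positivity

lemma pow_add_mul_pow_le {y : ℝ} (hy : 0 ≤ y) (t : ℕ) :
    y ^ (t + 1) + (t + 1) * y ^ t ≤ (y + 1) ^ (t + 1) := by
  induction t with
  | zero => simp
  | succ t ih =>
    have h1 : (0 : ℝ) ≤ y ^ t := by positivity
    have h2 : (0 : ℝ) ≤ t := Nat.cast_nonneg t
    calc y ^ (t + 1 + 1) + ((t + 1 : ℕ) + 1) * y ^ (t + 1)
        ≤ (y ^ (t + 1) + (t + 1) * y ^ t) * (y + 1) := by
          push_cast
          ring_nf
          nlinarith
      _ ≤ (y + 1) ^ (t + 1) * (y + 1) := by gcongr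
      _ = _ := by ring

lemma logb_two_le {u : ℝ} (hu : 1 ≤ u) (s : ℕ) (hs : 1 ≤ s) :
    Real.logb 2 u ≤ u / s + 4 * s := by
  have hs' : (1 : ℝ) ≤ s := by exact_mod_cast hs
  have h0 := Real.log_nonneg hu
  have h1 : Real.logb 2 u ≤ 2 * Real.log u := by
    rw [Real.logb, div_le_iff₀ (Real.log_pos (by norm_num))]
    have := Real.log_two_gt_d9
    nlinarith
  have h2 : Real.log u = Real.log (u / (2 * s)) + Real.log (2 * s) := by
    rw [← Real.log_mul (by positivity) (by positivity)]
    congr 1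
    field_simp
  have h3 := Real.log_le_sub_one_of_pos (x := u / (2 * s)) (by positivity)
  have h4 := Real.log_le_sub_one_of_pos (x := 2 * (s : ℝ)) (by positivity)
  have h5 : 2 * (u / (2 * s)) = u / s := by field_simp
  linarith

lemma goodExp_odd_step {t C1 C2 D2 : ℕ} (hC2 : 1 ≤ C2)
    (g1 : GoodExp (2 * t + 4) (evenExp (t + 1) C1))
    (g2 : GoodExp (2 * t + 3) (oddExp t C2 D2)) :
    ∃ C D : ℕ, 1 ≤ C ∧ GoodExp (2 * (t + 1) + 3) (oddExp (t + 1) C D) := by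
  obtain ⟨B, hB⟩ := exists_goodExp_step (2 * t + 2)
  set F := (t + 1).factorial with hF
  have hF1 : 1 ≤ F := Nat.factorial_pos _
  have hF1' : (1 : ℝ) ≤ F := by exact_mod_cast hF1
  have hG1 : (1 : ℝ) ≤ t.factorial := by exact_mod_cast Nat.factorial_pos t
  have hFG : (F : ℝ) = (t + 1) * t.factorial := by
    rw [hF, Nat.factorial_succ]; push_cast; ring
  have ht0 : (0 : ℝ) ≤ t := Nat.cast_nonneg t
  refine ⟨C1 + C2 + 1 + B * F, D2 + 3 * F + 1, by omega,
    hB _ _ _ g2 g1 ?_ (evenExp_nonneg _ _) (fun m => oddExp_nonneg _ _ m hC2) ?_ ?_⟩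
  · intro m
    set y : ℝ := m + ((C1 + C2 + 1 + B * F : ℕ) : ℝ) with hy
    have hm0 : (0 : ℝ) ≤ m := Nat.cast_nonneg m
    have hy1 : (1 : ℝ) ≤ y := by
      rw [hy]
      push_cast
      nlinarith [Nat.cast_nonneg (α := ℝ) B, Nat.cast_nonneg (α := ℝ) C1,
        Nat.cast_nonneg (α := ℝ) C2]
    have hyB : (B : ℝ) * F ≤ y := by
      rw [hy]; push_cast; linarith [Nat.cast_nonneg (α := ℝ) C1, Nat.cast_nonneg (α := ℝ) C2]
    have hl := logb_two_nonneg hy1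
    have h1 : (B : ℝ) ≤ y ^ (t + 1) / F := by
      rw [le_div_iff₀ (by linarith)]
      exact hyB.trans (le_self_pow₀ hy1 (by omega))
    have h2 : (1 : ℝ) ≤ Real.logb 2 y + ((D2 + 3 * F + 1 : ℕ) : ℝ) := by
      push_cast
      linarith [Nat.cast_nonneg (α := ℝ) D2]
    exact h1.trans (le_mul_of_one_le_right (by positivity) h2)
  · intro m
    set y : ℝ := m + ((C1 + C2 + 1 + B * F : ℕ) : ℝ) with hy
    set u : ℝ := ((m + 1 : ℕ) : ℝ) + C2 with hu
    set D : ℝ := ((D2 + 3 * F + 1 : ℕ) : ℝ) with hD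
    have hm0 : (0 : ℝ) ≤ m := Nat.cast_nonneg m
    have hC2' : (1 : ℝ) ≤ C2 := by exact_mod_cast hC2
    have hu1 : 1 ≤ u := by rw [hu]; push_cast; linarith
    have huy : u ≤ y := by
      rw [hu, hy]; push_cast
      have : (0 : ℝ) ≤ B * F := by positivity
      linarith [Nat.cast_nonneg (α := ℝ) C1]
    have hy1 : 1 ≤ y := hu1.trans huy
    have hl := logb_two_nonneg hy1
    have hlu := logb_two_nonneg hu1
    have hD0 : (D2 : ℝ) + 3 * t.factorial ≤ D := by
      rw [hD]; push_cast
      nlinarith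
    have hD2 : (0 : ℝ) ≤ D2 := Nat.cast_nonneg _
    have e1 : oddExp (t + 1) (C1 + C2 + 1 + B * F) (D2 + 3 * F + 1) m =
      y ^ (t + 1) / F * (Real.logb 2 y + D) := rfl
    have e2 : oddExp t C2 D2 (m + 1) = u ^ t / t.factorial * (Real.logb 2 u + D2) := rfl
    have e3 : oddExp (t + 1) (C1 + C2 + 1 + B * F) (D2 + 3 * F + 1) (m + 1) =
      (y + 1) ^ (t + 1) / F * (Real.logb 2 (y + 1) + D) := by
      have : (y + 1 : ℝ) = ((m + 1 : ℕ) : ℝ) + ((C1 + C2 + 1 + B * F : ℕ) : ℝ) := by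
        rw [hy]; push_cast; ring
      rw [this]; rfl
    rw [e1, e2, e3]
    have hll : Real.logb 2 y ≤ Real.logb 2 (y + 1) :=
      Real.logb_le_logb_of_le (by norm_num) (by linarith) (by linarith)
    have hluy : Real.logb 2 u ≤ Real.logb 2 y :=
      Real.logb_le_logb_of_le (by norm_num) (by linarith) huy
    have hpow := pow_add_mul_pow_le (y := y) (by linarith) t
    have hdiv : y ^ (t + 1) / F + y ^ t / t.factorial ≤ (y + 1) ^ (t + 1) / F := by
      have : y ^ (t + 1) / F + y ^ t / t.factorial = (y ^ (t + 1) + (t + 1) * y ^ t) / F := by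
        rw [hFG]; field_simp
      rw [this]
      gcongr
    have hu3 : u ^ t / t.factorial * (Real.logb 2 u + D2) + 3 ≤
        y ^ t / t.factorial * (Real.logb 2 y + D) := by
      have h3 : (3 : ℝ) ≤ u ^ t / t.factorial * (3 * t.factorial) := by
        have : u ^ t / t.factorial * (3 * t.factorial) = 3 * u ^ t := by field_simp
        rw [this]
        linarith [one_le_pow₀ hu1 (n := t)]
      calc _ ≤ u ^ t / t.factorial * (Real.logb 2 u + D2) +
            u ^ t / t.factorial * (3 * t.factorial) := by linarith
        _ = u ^ t / t.factorial * (Real.logb 2 u + (D2 + 3 * t.factorial)) := by ring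
        _ ≤ _ := by gcongr
    calc _ ≤ y ^ (t + 1) / F * (Real.logb 2 y + D) +
          y ^ t / t.factorial * (Real.logb 2 y + D) := by linarith
      _ = (y ^ (t + 1) / F + y ^ t / t.factorial) * (Real.logb 2 y + D) := by ring
      _ ≤ _ := by
        have : 0 ≤ Real.logb 2 y + D := by linarith
        gcongr
  · intro m
    set z : ℝ := ((m + 1 : ℕ) : ℝ) + ((C1 + C2 + 1 + B * F : ℕ) : ℝ) with hz
    set u : ℝ := ((m + 1 : ℕ) : ℝ) + C1 with hu
    set D : ℝ := ((D2 + 3 * F + 1 : ℕ) : ℝ) with hD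
    have hm0 : (0 : ℝ) ≤ m := Nat.cast_nonneg m
    have hu1 : 1 ≤ u := by rw [hu]; push_cast; linarith [Nat.cast_nonneg (α := ℝ) C1]
    have huz : u ≤ z := by
      rw [hu, hz]; push_cast
      have : (0 : ℝ) ≤ B * F := by positivity
      linarith [Nat.cast_nonneg (α := ℝ) C2]
    have hl := logb_two_nonneg (hu1.trans huz)
    have hD0 : (1 : ℝ) + 3 * F ≤ D := by
      rw [hD]; push_cast
      linarith [Nat.cast_nonneg (α := ℝ) D2]
    change u ^ (t + 1) / F + 3 ≤ z ^ (t + 1) / F * (Real.logb 2 z + D)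
    have h3 : (3 : ℝ) ≤ u ^ (t + 1) / F * (3 * F) := by
      have : u ^ (t + 1) / F * (3 * F) = 3 * u ^ (t + 1) := by field_simp
      rw [this]
      linarith [one_le_pow₀ hu1 (n := t + 1)]
    calc _ ≤ u ^ (t + 1) / F * (1 + 3 * F) := by linarith
      _ ≤ _ := by
        have : 1 + 3 * (F : ℝ) ≤ Real.logb 2 z + D := by linarith
        gcongr

lemma goodExp_even_step {t C1 C2 D1 : ℕ} (hC1 : 1 ≤ C1)
    (g1 : GoodExp (2 * t + 5) (oddExp (t + 1) C1 D1))
    (g2 : GoodExp (2 * t + 4) (evenExp (t + 1) C2)) :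
    ∃ C : ℕ, GoodExp (2 * (t + 1) + 4) (evenExp (t + 1 + 1) C) := by
  obtain ⟨B, hB⟩ := exists_goodExp_step (2 * t + 3)
  set F := (t + 1).factorial with hF
  set H := (t + 1 + 1).factorial with hH
  have hF1 : (1 : ℝ) ≤ F := by exact_mod_cast Nat.factorial_pos (t + 1)
  have hH1 : (1 : ℝ) ≤ H := by exact_mod_cast Nat.factorial_pos (t + 1 + 1)
  have hHF : (H : ℝ) = (t + 2) * F := by
    rw [hH, Nat.factorial_succ]; push_cast; ring
  have ht0 : (0 : ℝ) ≤ t := Nat.cast_nonneg t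
  set E := (t + 2) * (4 * (t + 2) + D1 + 3 * F) with hE
  set C := C1 + C2 + 1 + 3 * F + E + B * H with hC
  have hCr : (C : ℝ) = C1 + C2 + 1 + 3 * F + E + B * H := by rw [hC]; push_cast; ring
  have hBH : (0 : ℝ) ≤ B * H := by positivity
  have n1 := Nat.cast_nonneg (α := ℝ) C1
  have n2 := Nat.cast_nonneg (α := ℝ) C2
  have n3 := Nat.cast_nonneg (α := ℝ) E
  refine ⟨C, hB _ _ _ g2 g1 ?_ (fun m => oddExp_nonneg _ _ m hC1) (evenExp_nonneg _ _) ?_ ?_⟩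
  · intro m
    have hm0 : (0 : ℝ) ≤ m := Nat.cast_nonneg m
    change (B : ℝ) ≤ (m + C : ℝ) ^ (t + 1 + 1) / H
    rw [le_div_iff₀ (by linarith)]
    have hy1 : (1 : ℝ) ≤ m + C := by linarith
    refine le_trans ?_ (le_self_pow₀ hy1 (by omega))
    linarith
  · intro m
    have hm0 : (0 : ℝ) ≤ m := Nat.cast_nonneg m
    set y : ℝ := m + C with hy
    set u : ℝ := ((m + 1 : ℕ) : ℝ) + C2 with hu
    have hu1 : 1 ≤ u := by rw [hu]; push_cast; linarith
    have huy : u + 3 * F ≤ y := by rw [hu, hy]; push_cast; linarith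
    have e3 : evenExp (t + 1 + 1) C (m + 1) = (y + 1) ^ (t + 1 + 1) / H := by
      have : (y + 1 : ℝ) = ((m + 1 : ℕ) : ℝ) + (C : ℝ) := by rw [hy]; push_cast; ring
      rw [this]; rfl
    rw [e3]
    change y ^ (t + 1 + 1) / H + u ^ (t + 1) / F + 3 ≤ _
    have hpow := pow_add_mul_pow_le (y := y) (by linarith) (t + 1)
    have hdiv : y ^ (t + 1 + 1) / H + y ^ (t + 1) / F ≤ (y + 1) ^ (t + 1 + 1) / H := by
      have : y ^ (t + 1 + 1) / H + y ^ (t + 1) / F =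
          (y ^ (t + 1 + 1) + ((t + 1 : ℕ) + 1) * y ^ (t + 1)) / H := by
        rw [hHF]; push_cast; field_simp; ring
      rw [this]
      gcongr
    have h1 : u ^ (t + 1) / F + 3 ≤ y ^ (t + 1) / F := by
      have h2 : u ^ (t + 1) / F + 3 = (u ^ (t + 1) + 3 * F) / F := by field_simp
      rw [h2]
      gcongr
      have h3 : (1 : ℝ) ≤ u ^ t := one_le_pow₀ hu1
      calc u ^ (t + 1) + 3 * F ≤ u ^ t * (u + 3 * F) := by
            rw [pow_succ]; nlinarith
        _ ≤ y ^ t * y := by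
            have : u ≤ y := by linarith
            gcongr
        _ = _ := (pow_succ _ _).symm
    linarith
  · intro m
    have hm0 : (0 : ℝ) ≤ m := Nat.cast_nonneg m
    set z : ℝ := ((m + 1 : ℕ) : ℝ) + C with hz
    set u : ℝ := ((m + 1 : ℕ) : ℝ) + C1 with hu
    have hu1 : 1 ≤ u := by rw [hu]; push_cast; linarith
    have huz : u + E ≤ z := by rw [hu, hz]; linarith
    change u ^ (t + 1) / F * (Real.logb 2 u + D1) + 3 ≤ z ^ (t + 1 + 1) / H
    have hlog := logb_two_le hu1 (t + 2) (by omega)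
    push_cast at hlog
    have hz2 : Real.logb 2 u + D1 + 3 * F ≤ z / (t + 2) := by
      have h1 : (u + E) / (t + 2) ≤ z / (t + 2) := by gcongr
      have h2 : (u + E) / (t + 2) = u / (t + 2) + (4 * (t + 2) + D1 + 3 * F) := by
        rw [hE]; push_cast; field_simp
      linarith
    have hu0 : 0 ≤ Real.logb 2 u + D1 + 3 * F := by
      have := logb_two_nonneg hu1
      positivity
    have h3 : (3 : ℝ) ≤ u ^ (t + 1) / F * (3 * F) := by
      have : u ^ (t + 1) / F * (3 * F) = 3 * u ^ (t + 1) := by field_simp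
      rw [this]
      linarith [one_le_pow₀ hu1 (n := t + 1)]
    calc _ ≤ u ^ (t + 1) / F * (Real.logb 2 u + D1 + 3 * F) := by linarith
      _ ≤ z ^ (t + 1) / F * (z / (t + 2)) := by
          have : u ≤ z := by linarith
          gcongr
      _ = _ := by rw [hHF]; field_simp; ring

lemma exists_goodExp (t : ℕ) :
    (∃ C, GoodExp (2 * t + 4) (evenExp (t + 1) C)) ∧
      ∃ C D, 1 ≤ C ∧ GoodExp (2 * t + 3) (oddExp t C D) := by
  induction t with
  | zero =>
    constructor
    · obtain ⟨C, hC⟩ := exists_goodSeq_four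
      refine ⟨C, hC.mono fun m => ?_⟩
      have : (2 : ℝ) ^ evenExp (0 + 1) C m = ((2 ^ (m + C) : ℕ) : ℝ) := by
        have h : evenExp (0 + 1) C m = ((m + C : ℕ) : ℝ) := by simp [evenExp]
        rw [h, Real.rpow_natCast]
        push_cast
        rfl
      rw [this, Nat.ceil_natCast]
    · obtain ⟨b, hb⟩ := exists_goodSeq_three
      refine ⟨b + 1, 2, by omega, hb.mono fun m => ?_⟩
      have : (2 : ℝ) ^ oddExp 0 (b + 1) 2 m = ((4 * (m + (b + 1)) : ℕ) : ℝ) := by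
        have h : oddExp 0 (b + 1) 2 m = Real.logb 2 (m + (b + 1 : ℕ)) + (2 : ℕ) := by
          simp [oddExp]
        rw [h, Real.rpow_add (by norm_num), Real.rpow_natCast,
          Real.rpow_logb (by norm_num) (by norm_num) (by positivity)]
        push_cast
        ring
      rw [this, Nat.ceil_natCast]
      omega
  | succ t ih =>
    obtain ⟨⟨C2, g2⟩, C, D, hC, g3⟩ := ih
    obtain ⟨C', D', hC', g'⟩ := goodExp_odd_step hC g2 g3
    exact ⟨goodExp_even_step hC' g' g2, C', D', hC', g'⟩

lemma exists_pow_shift_le (C t : ℕ) : ∃ C' : ℕ, ∀ m : ℕ, 1 ≤ m →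
    ((m : ℝ) + C) ^ t ≤ (m : ℝ) ^ t * (1 + C' / m) := by
  induction t with
  | zero => exact ⟨0, fun m _ => by simp⟩
  | succ t ih =>
    obtain ⟨C', h⟩ := ih
    refine ⟨C' + C + C' * C, fun m hm => ?_⟩
    have hm1 : (1 : ℝ) ≤ m := by exact_mod_cast hm
    have hm0 : (0 : ℝ) < m := by linarith
    have h1 := h m hm
    have h2 : (C' : ℝ) * C / m / m ≤ C' * C / m := div_le_self (by positivity) hm1
    calc ((m : ℝ) + C) ^ (t + 1) = ((m : ℝ) + C) ^ t * (m + C) := pow_succ _ _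
      _ ≤ (m : ℝ) ^ t * (1 + C' / m) * (m + C) := by gcongr
      _ = (m : ℝ) ^ (t + 1) * (1 + (C' + C) / m + C' * C / m / m) := by field_simp; ring
      _ ≤ (m : ℝ) ^ (t + 1) * (1 + (C' + C) / m + C' * C / m) := by gcongr
      _ = _ := by push_cast; ring

lemma evenExp_asymp (t C c : ℕ) : ∃ C' : ℝ, 0 < C' ∧ ∀ m : ℕ, 2 ≤ m →
    evenExp (t + 1) C (m - 1) + c ≤
      (1 + C' * (1 / m)) * ((m : ℝ) ^ (t + 1) / ((t + 1).factorial : ℝ)) := by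
  obtain ⟨C1, h1⟩ := exists_pow_shift_le C (t + 1)
  set F : ℝ := ((t + 1).factorial : ℝ) with hF
  have hF1 : (1 : ℝ) ≤ F := by rw [hF]; exact_mod_cast Nat.factorial_pos (t + 1)
  refine ⟨C1 + c * F + 1, by positivity, fun m hm => ?_⟩
  have hm1 : (1 : ℝ) ≤ m := by exact_mod_cast (by omega : 1 ≤ m)
  have e1 : evenExp (t + 1) C (m - 1) ≤ (m : ℝ) ^ (t + 1) * (1 + C1 / m) / F := by
    unfold evenExp
    refine div_le_div_of_nonneg_right (le_trans ?_ (h1 m (by omega))) (by linarith)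
    have : ((m - 1 : ℕ) : ℝ) ≤ m := by exact_mod_cast Nat.sub_le m 1
    gcongr
  have e2 : (c : ℝ) ≤ c * F * (1 / m) * ((m : ℝ) ^ (t + 1) / F) := by
    have : (c : ℝ) * F * (1 / m) * ((m : ℝ) ^ (t + 1) / F) = c * (m : ℝ) ^ t := by
      field_simp
      ring
    rw [this]
    exact le_mul_of_one_le_right (Nat.cast_nonneg c) (one_le_pow₀ hm1)
  have e3 : 0 ≤ 1 / (m : ℝ) * ((m : ℝ) ^ (t + 1) / F) := by positivity
  calc _ ≤ (m : ℝ) ^ (t + 1) * (1 + C1 / m) / F +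
        c * F * (1 / m) * ((m : ℝ) ^ (t + 1) / F) +
        1 / (m : ℝ) * ((m : ℝ) ^ (t + 1) / F) := by linarith
    _ = _ := by ring

lemma oddExp_asymp (t D c : ℕ) {C : ℕ} (hC : 1 ≤ C) : ∃ C' : ℝ, 0 < C' ∧ ∀ m : ℕ, 2 ≤ m →
    oddExp t C D (m - 1) + c ≤
      (1 + C' * (1 / Real.logb 2 m)) *
        (((m : ℝ) ^ t / (t.factorial : ℝ)) * Real.logb 2 m) := by
  obtain ⟨C1, h1⟩ := exists_pow_shift_le C t
  set F : ℝ := (t.factorial : ℝ) with hF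
  have hF1 : (1 : ℝ) ≤ F := by rw [hF]; exact_mod_cast Nat.factorial_pos t
  set L := Real.logb 2 (1 + C) with hL
  have hL0 : 0 ≤ L := logb_two_nonneg (by linarith [Nat.cast_nonneg (α := ℝ) C])
  refine ⟨5 * C1 + (1 + C1) * (L + D) + c * F + 1, by positivity, fun m hm => ?_⟩
  have hm1 : (1 : ℝ) ≤ m := by exact_mod_cast (by omega : 1 ≤ m)
  have hm0 : (0 : ℝ) < m := by linarith
  have hC1' : (1 : ℝ) ≤ C := by exact_mod_cast hC
  set l := Real.logb 2 m with hl
  have hl0 : 0 < l := Real.logb_pos (by norm_num) (by exact_mod_cast (by omega : 1 < m))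
  have hle : ((m - 1 : ℕ) : ℝ) ≤ m := by exact_mod_cast Nat.sub_le m 1
  have hge : (0 : ℝ) ≤ ((m - 1 : ℕ) : ℝ) := Nat.cast_nonneg _
  have hlog : Real.logb 2 (((m - 1 : ℕ) : ℝ) + C) ≤ l + L := by
    rw [hl, hL, ← Real.logb_mul (by positivity) (by positivity)]
    refine Real.logb_le_logb_of_le (by norm_num) (by linarith) ?_
    nlinarith
  have hlog0 : 0 ≤ Real.logb 2 (((m - 1 : ℕ) : ℝ) + C) := logb_two_nonneg (by linarith)
  have hlm : l / m ≤ 5 := by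
    rw [div_le_iff₀ hm0]
    have := logb_two_le hm1 1 le_rfl
    simp only [Nat.cast_one, div_one, mul_one] at this
    linarith
  have e1 : oddExp t C D (m - 1) ≤ (m : ℝ) ^ t * (1 + C1 / m) / F * (l + L + D) := by
    unfold oddExp
    have : ((m - 1 : ℕ) + C : ℝ) ^ t ≤ (m : ℝ) ^ t * (1 + C1 / m) := by
      refine le_trans ?_ (h1 m (by omega))
      gcongr
    gcongr
  set U := (m : ℝ) ^ t / F with hU
  have hU0 : 0 ≤ U := by positivity
  have e2 : (c : ℝ) ≤ U * (c * F) := by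
    have : U * (c * F) = c * (m : ℝ) ^ t := by rw [hU]; field_simp
    rw [this]
    exact le_mul_of_one_le_right (Nat.cast_nonneg c) (one_le_pow₀ hm1)
  have e3 : (1 + C1 / m) * (l + L + D) ≤ l + (5 * C1 + (1 + C1) * (L + D)) := by
    have h2 : (C1 : ℝ) / m ≤ C1 := div_le_self (Nat.cast_nonneg _) hm1
    have h3 : (C1 : ℝ) * (l / m) ≤ C1 * 5 := by gcongr
    have h4 : (C1 : ℝ) / m * (L + D) ≤ C1 * (L + D) := by gcongr
    calc (1 + C1 / m) * (l + L + D) = l + C1 * (l / m) + (L + D) + C1 / m * (L + D) := by ring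
      _ ≤ _ := by linarith
  have e4 : (m : ℝ) ^ t * (1 + C1 / m) / F * (l + L + D) =
      U * ((1 + C1 / m) * (l + L + D)) := by rw [hU]; ring
  have e5 : (1 + (5 * C1 + (1 + C1) * (L + D) + c * F + 1) * (1 / l)) * (U * l) =
      U * (l + (5 * C1 + (1 + C1) * (L + D)) + c * F + 1) := by field_simp; ring
  rw [e5]
  rw [e4] at e1
  have e6 := mul_le_mul_of_nonneg_left e3 hU0
  nlinarith

/-- In every dimension `d ≥ 3` there are chain lengths matching the claimed exponent. -/
lemma exists_goodExp_dim (d : ℕ) (hd : 3 ≤ d) : ∃ f : ℕ → ℝ, GoodExp d f ∧ (∀ m, 0 ≤ f m) ∧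
    (∃ a e : ℕ, ∀ m, f m ≤ (((m + a) ^ e : ℕ) : ℝ)) ∧
    ∀ c : ℕ, ∃ C : ℝ, 0 < C ∧ ∀ r : ℝ, 2 ≤ alphaA r →
      f (alphaA r - 1) + c ≤ (1 + C * deltaD d r) * betaD d r := by
  rcases Nat.even_or_odd d with hev | hodd
  · obtain ⟨t, rfl⟩ : ∃ t, d = 2 * t + 4 := by
      obtain ⟨s, rfl⟩ := hev
      exact ⟨s - 2, by omega⟩
    obtain ⟨C, hC⟩ := (exists_goodExp t).1
    refine ⟨_, hC, evenExp_nonneg _ _, ⟨C, t + 1, fun m => ?_⟩, fun c => ?_⟩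
    · push_cast
      exact div_le_self (by positivity) (by exact_mod_cast Nat.factorial_pos (t + 1))
    · obtain ⟨C', h0, h⟩ := evenExp_asymp t C c
      refine ⟨C', h0, fun r hr => ?_⟩
      have e1 : (2 * t + 4) % 2 = 0 := by omega
      have e2 : (2 * t + 4) / 2 - 1 = t + 1 := by omega
      rw [deltaD, betaD, if_pos e1, if_pos e1, e2]
      exact h _ hr
  · obtain ⟨t, rfl⟩ : ∃ t, d = 2 * t + 3 := by
      obtain ⟨s, rfl⟩ := hodd
      exact ⟨s - 1, by omega⟩
    obtain ⟨C, D, hC1, hC⟩ := (exists_goodExp t).2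
    refine ⟨_, hC, fun m => oddExp_nonneg _ _ m hC1, ⟨C + 4 + D, t + 1, fun m => ?_⟩,
      fun c => ?_⟩
    · have hC1' : (1 : ℝ) ≤ C := by exact_mod_cast hC1
      have hm0 : (0 : ℝ) ≤ m := Nat.cast_nonneg m
      have h1 : (1 : ℝ) ≤ m + C := by linarith
      have h2 := logb_two_le h1 1 le_rfl
      have h3 := logb_two_nonneg h1
      simp only [Nat.cast_one, div_one, mul_one] at h2
      have h4 : (m + C : ℝ) ^ t / (t.factorial : ℝ) ≤ (m + C : ℝ) ^ t :=
        div_le_self (by positivity) (by exact_mod_cast Nat.factorial_pos t)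
      push_cast
      rw [pow_succ]
      have h5 : (m + C : ℝ) ≤ m + (C + 4 + D) := by linarith [Nat.cast_nonneg (α := ℝ) D]
      unfold oddExp
      calc _ ≤ (m + C : ℝ) ^ t * (Real.logb 2 (m + C) + D) := by gcongr
        _ ≤ _ := mul_le_mul (pow_le_pow_left₀ (by positivity) h5 t) (by linarith)
          (by positivity) (by positivity)
    · obtain ⟨C', h0, h⟩ := oddExp_asymp t D c hC1
      refine ⟨C', h0, fun r hr => ?_⟩
      have e1 : ¬ (2 * t + 3) % 2 = 0 := by omega
      have e2 : (2 * t + 3) / 2 - 1 = t := by omega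
      rw [deltaD, betaD, if_neg e1, if_neg e1, e2]
      exact h _ hr

lemma stretchedDiag_card {d : ℕ} (hd : 1 ≤ d) (n : ℕ) : (stretchedDiag d n).card = n := by
  classical
  have h : Set.InjOn (fun j => fun i : Fin d => (stretchK d n i) ^ j)
      (Finset.range n : Set ℕ) := by
    intro a _ b _ hab
    have h1 := congrFun hab ⟨0, hd⟩
    have h2 : (1 : ℝ) < stretchK d n 0 := one_lt_pow₀ (by norm_num) (by omega)
    exact pow_right_injective₀ (by linarith) h2.ne' h1
  unfold stretchedDiag
  rw [Finset.card_image_of_injOn h, Finset.card_range]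

/-- A stabbing family yields a weak net for the diagonal. -/
lemma exists_weakNet_of_hasStab {d n k N' M : ℕ} (hd : 1 ≤ d) (hn : 2 ≤ n) {r : ℝ} (hr : 1 ≤ r)
    (h : HasStab d k N' M) (hN : 9 * (k + 1) * r ≤ N') :
    ∃ N : Finset (Fin d → ℝ), IsWeakNet (stretchedDiag d n) (1 / r) (↑N : Set (Fin d → ℝ)) ∧
      (N.card : ℝ) ≤ 4 * (k + 1) * r + 2 * M := by
  classical
  have hcard := stretchedDiag_card hd n
  have hr0 : 0 < r := by linarith
  have hn0 : (0 : ℝ) < n := by exact_mod_cast (by omega : 0 < n)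
  have hk0 : (0 : ℝ) ≤ k := Nat.cast_nonneg k
  have hM0 : (0 : ℝ) ≤ M := Nat.cast_nonneg M
  have hkr : 0 < 4 * (k + 1) * r := by positivity
  rcases le_or_gt (n : ℝ) (4 * (k + 1) * r) with hsmall | hbig
  · refine ⟨stretchedDiag d n, ?_, by rw [hcard]; linarith⟩
    intro C _ hc
    rw [hcard] at hc
    have h1 : 0 < 1 / r * (n : ℝ) := by positivity
    have h2 : 0 < ((stretchedDiag d n).filter (fun p => p ∈ C)).card := by
      have := h1.trans_le hc
      exact_mod_cast this
    obtain ⟨p, hp⟩ := Finset.card_pos.1 h2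
    have hp' := Finset.mem_filter.1 hp
    exact ⟨p, Finset.mem_coe.2 hp'.1, hp'.2⟩
  obtain ⟨T, hT, hst⟩ := h
  set z : ℝ := n / (4 * (k + 1) * r) with hz
  have hz1 : 1 ≤ z := (one_le_div hkr).2 hbig.le
  set L := ⌊z⌋₊ with hL
  have hL1 : 1 ≤ L := Nat.le_floor (by simpa using hz1)
  have hLz : (L : ℝ) ≤ z := Nat.floor_le (by linarith)
  have hzL : z < 2 * L := by
    have h1 := Nat.lt_floor_add_one z
    have h2 : (1 : ℝ) ≤ L := by exact_mod_cast hL1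
    rw [← hL] at h1
    linarith
  let pt : ℕ → (ℕ → ℕ) → (Fin d → ℝ) := fun ε p l =>
    stretchK d n l ^ (2 * (L * (p l + 1)) + ε - 1)
  refine ⟨T.image (pt 0) ∪ T.image (pt 1), ?_, ?_⟩
  swap
  · have h1 : (T.image (pt 0) ∪ T.image (pt 1)).card ≤ 2 * M := by
      refine (Finset.card_union_le _ _).trans ?_
      have e1 : (T.image (pt 0)).card ≤ _ := Finset.card_image_le
      have e2 : (T.image (pt 1)).card ≤ _ := Finset.card_image_le
      omega
    have h2 : ((T.image (pt 0) ∪ T.image (pt 1)).card : ℝ) ≤ 2 * M := by exact_mod_cast h1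
    linarith
  intro C hC hc
  rw [hcard] at hc
  let X : ℕ → (Fin d → ℝ) := fun j => fun i : Fin d => (stretchK d n i) ^ j
  set J := (Finset.range n).filter (fun j => X j ∈ C) with hJ
  have hJc : (n : ℝ) / r ≤ J.card := by
    have h1 : ((stretchedDiag d n).filter (fun p => p ∈ C)).card ≤ J.card := by
      have : (stretchedDiag d n).filter (fun p => p ∈ C) ⊆ J.image X := by
        intro p hp
        obtain ⟨hp1, hp2⟩ := Finset.mem_filter.1 hp
        obtain ⟨j, hj, rfl⟩ := Finset.mem_image.1 hp1
        exact Finset.mem_image.2 ⟨j, Finset.mem_filter.2 ⟨hj, hp2⟩, rfl⟩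
      exact (Finset.card_le_card this).trans Finset.card_image_le
    have h2 : (((stretchedDiag d n).filter (fun p => p ∈ C)).card : ℝ) ≤ J.card := by
      exact_mod_cast h1
    calc (n : ℝ) / r = 1 / r * n := by ring
      _ ≤ _ := le_trans (by convert hc) h2
  have main : ∀ ε ≤ 1, (n : ℝ) / r ≤ 2 * (J.filter (fun j => j % 2 = ε)).card →
      ∃ p ∈ T, pt ε p ∈ C := by
    intro ε hε hcε
    set J' := J.filter (fun j => j % 2 = ε) with hJ'
    set S := J'.image (fun j => j / 2 / L) with hS
    have hJ'S : J'.card ≤ L * S.card := by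
      have himg : (J'.image (fun j => j / 2)).card = J'.card := by
        refine Finset.card_image_of_injOn fun u hu v hv huv => ?_
        have h1 := (Finset.mem_filter.1 hu).2
        have h2 := (Finset.mem_filter.1 hv).2
        omega
      have hS' : S = (J'.image (fun j => j / 2)).image (fun c => c / L) := by
        rw [Finset.image_image]; rfl
      rw [hS', ← himg]
      refine Finset.card_le_mul_card_image _ L fun b _ => ?_
      calc _ ≤ (Finset.Ico (b * L) (b * L + L)).card := by
            refine Finset.card_le_card fun c hcm => ?_
            have h1 := (Finset.mem_filter.1 hcm).2
            have h2 := Nat.div_add_mod c L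
            have h3 := Nat.mod_lt c hL1
            rw [h1, mul_comm] at h2
            exact Finset.mem_Ico.2 ⟨by omega, by omega⟩
        _ = L := by simp
    have hSk : k < S.card := by
      have h1 : (J'.card : ℝ) ≤ L * S.card := by exact_mod_cast hJ'S
      have h2 : (n : ℝ) / r = z * (4 * (k + 1)) := by rw [hz]; field_simp
      have h3 : (0 : ℝ) < z := by linarith
      have h4 : (L : ℝ) * S.card ≤ z * S.card := by gcongr
      have h5 : z * (2 * (k + 1)) ≤ z * S.card := by linarith
      have h6 := le_of_mul_le_mul_left h5 h3
      have h7 : (k : ℝ) < S.card := by linarith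
      exact_mod_cast h7
    have hSN : ∀ i ∈ S, i < N' := by
      intro i hi
      obtain ⟨j, hj, rfl⟩ := Finset.mem_image.1 hi
      have hjn : j < n := Finset.mem_range.1 (Finset.mem_filter.1 (Finset.mem_filter.1 hj).1).1
      have h1 : ((j / 2 / L : ℕ) : ℝ) * L ≤ n := by
        have e1 : j / 2 / L * L ≤ j / 2 := Nat.div_mul_le_self _ _
        have e2 : j / 2 / L * L ≤ n := by omega
        exact_mod_cast e2
      have hL0 : (0 : ℝ) < L := by exact_mod_cast hL1
      have h2 : (n : ℝ) < 8 * (k + 1) * r * L := by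
        have : (n : ℝ) = z * (4 * (k + 1) * r) := by rw [hz]; field_simp
        rw [this]
        nlinarith
      have h3 : ((j / 2 / L : ℕ) : ℝ) < 8 * (k + 1) * r := by
        by_contra hcon
        have := mul_le_mul_of_nonneg_right (not_lt.1 hcon) hL0.le
        linarith
      have h4 : ((j / 2 / L : ℕ) : ℝ) < N' := by
        have : 0 ≤ (k + 1) * r := by positivity
        nlinarith
      exact_mod_cast h4
    obtain ⟨p, hp, s, hs1, hs2⟩ := hst S hSN hSk
    refine ⟨p, hp, ?_⟩
    have hex : ∀ i, ∃ j, i ≤ d → j ∈ J' ∧ j / 2 / L = s i := by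
      intro i
      by_cases hi : i ≤ d
      · obtain ⟨j, hj⟩ := Finset.mem_image.1 (hs1 i hi)
        exact ⟨j, fun _ => hj⟩
      · exact ⟨0, fun h => absurd h hi⟩
    choose x hx using hex
    refine mem_of_interleave (x := x) (e := fun l => 2 * (L * (p l + 1)) + ε - 1) hn hC
      (fun i hi => ?_) (fun i hi => ?_) (fun i hi => ?_)
    · exact Finset.mem_range.1 (Finset.mem_filter.1 (Finset.mem_filter.1 (hx i hi).1).1).1
    · exact (Finset.mem_filter.1 (Finset.mem_filter.1 (hx i hi).1).1).2
    · obtain ⟨ha, hb⟩ := hs2 i hi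
      have p1 := (Finset.mem_filter.1 (hx i hi.le).1).2
      have p2 := (Finset.mem_filter.1 (hx (i + 1) hi).1).2
      rw [← (hx i hi.le).2] at ha
      rw [← (hx (i + 1) hi).2] at hb
      have h3 : x i / 2 < L * (p i + 1) := by
        have := (Nat.div_lt_iff_lt_mul hL1).1 (Nat.lt_succ_of_le ha)
        rwa [mul_comm] at this
      have h4 : L * (p i + 1) ≤ x (i + 1) / 2 := by
        have := (Nat.le_div_iff_mul_le hL1).1 (Nat.succ_le_of_lt hb)
        rwa [mul_comm] at this
      omega
  have hsplit : J.card = (J.filter (fun j => j % 2 = 0)).card +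
      (J.filter (fun j => j % 2 = 1)).card := by
    rw [← Finset.card_filter_add_card_filter_not (s := J) (fun j => j % 2 = 0)]
    congr 2
    refine Finset.filter_congr fun j _ => ?_
    omega
  have hsplit' : (J.card : ℝ) = (J.filter (fun j => j % 2 = 0)).card +
      (J.filter (fun j => j % 2 = 1)).card := by exact_mod_cast hsplit
  rcases le_total ((J.filter (fun j => j % 2 = 1)).card : ℝ)
    (J.filter (fun j => j % 2 = 0)).card with hle | hle
  · obtain ⟨p, hp, hpC⟩ := main 0 (by norm_num) (by linarith)
    exact ⟨_, Finset.mem_coe.2 (Finset.mem_union_left _ (Finset.mem_image_of_mem _ hp)), hpC⟩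
  · obtain ⟨p, hp, hpC⟩ := main 1 le_rfl (by linarith)
    exact ⟨_, Finset.mem_coe.2 (Finset.mem_union_right _ (Finset.mem_image_of_mem _ hp)), hpC⟩

lemma ackH_two (m : ℕ) : ackH m 2 = 4 := by
  induction m with
  | zero => simp [ackH]
  | succ m ih => rw [ackH, ackH_at_one, ih]

lemma two_pow_le_ackH_three (m : ℕ) : 2 ^ m ≤ ackH m 3 := by
  induction m with
  | zero => simp [ackH]
  | succ m ih =>
    have h : ackH (m + 1) 3 = ackH m 4 := by rw [ackH, ackH_two]
    rw [h]
    rcases m with _ | _ | m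
    · simp [ackH]
    · simp [ackH_one]
    · have := pow_mul_ackH_le m 3 1
      calc 2 ^ (m + 2 + 1) = 2 ^ 1 * 2 ^ (m + 2) := by ring
        _ ≤ 2 ^ 1 * ackH (m + 2) 3 := Nat.mul_le_mul_left _ ih
        _ ≤ _ := this

lemma le_ackA_alphaA (r : ℝ) : r ≤ ackA (alphaA r) := by
  have hne : {n : ℕ | 1 ≤ n ∧ r ≤ ackA n}.Nonempty := by
    obtain ⟨n, hn⟩ := exists_nat_ge r
    refine ⟨n + 1, by omega, hn.trans ?_⟩
    have h1 := two_pow_le_ackH_three n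
    have h2 : n ≤ ackH n 3 := Nat.lt_two_pow_self.le.trans h1
    exact_mod_cast h2
  exact (Nat.sInf_mem hne).2

lemma exists_le_alphaA (m : ℕ) : ∃ r₀ : ℝ, ∀ r, r₀ ≤ r → m ≤ alphaA r := by
  refine ⟨∑ i ∈ Finset.range m, (ackA i : ℝ) + 1, fun r hr => ?_⟩
  by_contra hcon
  have h1 : (ackA (alphaA r) : ℝ) ≤ ∑ i ∈ Finset.range m, (ackA i : ℝ) :=
    Finset.single_le_sum (f := fun i => (ackA i : ℝ)) (fun i _ => Nat.cast_nonneg _)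
      (Finset.mem_range.2 (not_le.1 hcon))
  have h2 := le_ackA_alphaA r
  linarith

/-- Upper bound: for `d ≥ 3` and all large `r`, the diagonal `diag(n)` of the stretched
grid has a weak `1/r`-net of size at most `r · 2^{(1 + C·δ_d(r))·β_d(r)}`. -/
theorem weak_net_diagonal_upper_bound (d : ℕ) (hd : 3 ≤ d) :
    ∃ C : ℝ, 0 < C ∧ ∃ r₀ : ℝ, ∀ r : ℝ, r₀ ≤ r → ∀ n : ℕ, 2 ≤ n →
      ∃ N : Finset (Fin d → ℝ),
        IsWeakNet (stretchedDiag d n) (1 / r) (↑N : Set (Fin d → ℝ)) ∧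
        (N.card : ℝ) ≤ r * (2 : ℝ) ^ ((1 + C * deltaD d r) * betaD d r) := by
  obtain ⟨f, hf, hf0, ⟨a, e, hpoly⟩, hasymp⟩ := exists_goodExp_dim d hd
  obtain ⟨c, q, hstab⟩ := hf.hasStab_of_le
  obtain ⟨h₀, hh₀⟩ := exists_mul_pow_le_two_pow 7 (a + 1) e
  set c0 : ℕ := 4 + 20 * (c * 5 ^ q) with hc0
  obtain ⟨C, hC, hCb⟩ := hasymp (c0 + 2)
  obtain ⟨r₁, hr₁⟩ := exists_le_alphaA (h₀ + 3)
  refine ⟨C, hC, max r₁ 1, fun r hr n hn => ?_⟩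
  have hr1 : 1 ≤ r := (le_max_right _ _).trans hr
  have hα := hr₁ r ((le_max_left _ _).trans hr)
  obtain ⟨m, hm⟩ : ∃ m, alphaA r = m + 3 := ⟨alphaA r - 3, by omega⟩
  have hrY := le_ackA_alphaA r
  rw [hm] at hrY
  change r ≤ ackH (m + 2) 3 at hrY
  set Y := ackH (m + 2) 3 with hY
  set k := ⌈(2 : ℝ) ^ f (m + 2)⌉₊ with hk
  have hk1 : (k : ℝ) + 1 ≤ 2 ^ (f (m + 2) + 2) := by
    have h1 := ceil_two_rpow_le (hf0 (m + 2))
    have h2 : (1 : ℝ) ≤ 2 ^ (f (m + 2) + 1) :=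
      Real.one_le_rpow (by norm_num) (by linarith [hf0 (m + 2)])
    have h3 : (2 : ℝ) ^ (f (m + 2) + 2) = 2 ^ (f (m + 2) + 1) * 2 := by
      rw [show f (m + 2) + 2 = f (m + 2) + 1 + 1 by ring,
        Real.rpow_add (by norm_num) (f (m + 2) + 1),
        Real.rpow_one]
    rw [h3]
    linarith
  have hfY : f (m + 2) + 6 ≤ Y := by
    have h1 := hh₀ (m + 2) (by omega)
    have h2 : 1 ≤ (m + 2 + (a + 1)) ^ e := Nat.one_le_pow _ _ (by omega)
    have h3 : (m + 2 + a) ^ e ≤ (m + 2 + (a + 1)) ^ e := Nat.pow_le_pow_left (by omega) _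
    have h4 : (m + 2 + a) ^ e + 6 ≤ Y := by
      have := two_pow_le_ackH_three (m + 2)
      omega
    have h5 := hpoly (m + 2)
    have h6 : (((m + 2 + a) ^ e : ℕ) : ℝ) + 6 ≤ Y := by exact_mod_cast h4
    linarith
  set N' := ⌈9 * ((k : ℝ) + 1) * r⌉₊ with hN'
  have hkr : 1 ≤ ((k : ℝ) + 1) * r := by
    have : (0 : ℝ) ≤ k := Nat.cast_nonneg k
    nlinarith
  have hN'le : (N' : ℝ) ≤ 10 * ((k + 1) * r) := by
    have := Nat.ceil_lt_add_one (a := 9 * ((k : ℝ) + 1) * r) (by nlinarith)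
    rw [← hN'] at this
    linarith
  have hN'ack : N' ≤ ackH (m + 2) 5 := by
    have h1 : (N' : ℝ) ≤ (2 : ℝ) ^ (2 * Y) := by
      have e1 : (Y : ℝ) ≤ 2 ^ Y := by exact_mod_cast Nat.lt_two_pow_self.le
      have e2 : (2 : ℝ) ^ (f (m + 2) + 2) * 16 ≤ 2 ^ Y := by
        have : (2 : ℝ) ^ (f (m + 2) + 2) * 16 = 2 ^ (f (m + 2) + 6) := by
          rw [show f (m + 2) + 6 = f (m + 2) + 2 + (4 : ℕ) by push_cast; ring,
            Real.rpow_add (by norm_num) (f (m + 2) + 2), Real.rpow_natCast]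
          norm_num
        rw [this, ← Real.rpow_natCast]
        exact Real.rpow_le_rpow_of_exponent_le (by norm_num) hfY
      calc (N' : ℝ) ≤ 10 * ((k + 1) * r) := hN'le
        _ ≤ 16 * (2 ^ (f (m + 2) + 2) * Y) := by gcongr; norm_num
        _ = 2 ^ (f (m + 2) + 2) * 16 * Y := by ring
        _ ≤ 2 ^ Y * 2 ^ Y := by gcongr
        _ = _ := by rw [← pow_add, two_mul]
    have h2 : N' ≤ 2 ^ (2 * Y) := by exact_mod_cast h1
    refine h2.trans (le_trans ?_ (two_pow_ackH_le m 4))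
    refine Nat.pow_le_pow_right (by norm_num) ?_
    exact pow_mul_ackH_le m 3 1
  have hst := hstab (m + 2) (by omega) 5 (by norm_num) N' hN'ack
  obtain ⟨N, hN, hNc⟩ := exists_weakNet_of_hasStab (by omega) hn hr1 hst (Nat.le_ceil _)
  refine ⟨N, hN, hNc.trans ?_⟩
  have hexp := hCb r (by omega)
  rw [hm, show m + 3 - 1 = m + 2 by omega] at hexp
  push_cast at hexp
  have hc0r : (c0 : ℝ) = 4 + 20 * (c * 5 ^ q) := by rw [hc0]; push_cast; ring
  calc 4 * ((k : ℝ) + 1) * r + 2 * ((c * 5 ^ q * N' : ℕ) : ℝ)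
      ≤ 4 * ((k : ℝ) + 1) * r + 2 * (c * 5 ^ q * (10 * ((k + 1) * r))) := by
        push_cast
        gcongr
    _ = r * (c0 * (k + 1)) := by rw [hc0r]; ring
    _ ≤ r * (2 ^ (c0 : ℝ) * 2 ^ (f (m + 2) + 2)) := by
        have : (c0 : ℝ) ≤ 2 ^ (c0 : ℝ) := by
          rw [Real.rpow_natCast]
          exact_mod_cast (Nat.lt_two_pow_self (n := c0)).le
        gcongr
    _ = r * 2 ^ (f (m + 2) + (c0 + 2)) := by
        rw [← Real.rpow_add (by norm_num)]
        ring_nf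
    _ ≤ _ := by
        refine mul_le_mul_of_nonneg_left ?_ (by linarith)
        exact Real.rpow_le_rpow_of_exponent_le (by norm_num) hexp
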